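/- arXiv:2403.13620 — 10 statements merged into one kernel-verified Lean document; each statement's English description precedes it below -/
import Mathlib

section
/- Let L > 0 and λ > 0 be real numbers, and let h : ℝ → ℝ be a continuous function with h(t) > 0 for all t ∈ [0,L] and h(0) = h(L) = 1. Then σ(λ,h,L) < Lλ/2. (This is the variational form of the paper's Theorem 1: every Steklov eigenvalue of the warped product [0,L]×_h Σ in the λ_j-mode satisfies σ_j(h) < Lλ_j/2.) -/
open Set intervalIntegral

/-- The Steklov–Rayleigh infimum `σ(λ, h, L)`: the infimum, over continuously
differentiable `a : ℝ → ℝ` with `a 0 ^ 2 + a L ^ 2 = 1`, of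
`∫₀ᴸ (a'(t)² h(t)² + λ a(t)²) dt`. -/
noncomputable def steklovRayleigh (lam L : ℝ) (h : ℝ → ℝ) : ℝ :=
  sInf { x : ℝ | ∃ a : ℝ → ℝ, ContDiff ℝ 1 a ∧ (a 0) ^ 2 + (a L) ^ 2 = 1 ∧
    x = ∫ t in (0:ℝ)..L, ((deriv a t) ^ 2 * (h t) ^ 2 + lam * (a t) ^ 2) }

/-- Every admissible function bounds the Steklov–Rayleigh infimum from above. -/
theorem steklovRayleigh_le {lam L : ℝ} (hL : 0 ≤ L) (hlam : 0 ≤ lam) (h : ℝ → ℝ) {a : ℝ → ℝ}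
    (ha : ContDiff ℝ 1 a) (hbd : (a 0) ^ 2 + (a L) ^ 2 = 1) :
    steklovRayleigh lam L h ≤
      ∫ t in (0:ℝ)..L, ((deriv a t) ^ 2 * (h t) ^ 2 + lam * (a t) ^ 2) := by
  refine csInf_le ⟨0, ?_⟩ ⟨a, ha, hbd, rfl⟩
  rintro x ⟨b, -, -, rfl⟩
  exact integral_nonneg hL fun t _ => by positivity

/-- The energy of the normalized perturbation `(1 - ε t (L - t)) / √2` of a constant. -/
theorem steklovRayleigh_le_quadratic {lam L : ℝ} (hL : 0 ≤ L) (hlam : 0 ≤ lam) {h : ℝ → ℝ}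
    (hcont : Continuous h) (ε : ℝ) :
    steklovRayleigh lam L h ≤ L * lam / 2 - ε * (lam * (L ^ 3 / 6)) +
      ε ^ 2 * ∫ t in (0:ℝ)..L,
        ((L - 2 * t) ^ 2 * (h t) ^ 2 + lam * (t * (L - t)) ^ 2) / 2 := by
  have hs : (√2)⁻¹ ^ 2 = (1 / 2 : ℝ) := by
    rw [inv_pow, Real.sq_sqrt (by norm_num)]; norm_num
  have hderiv (t : ℝ) : deriv (fun t : ℝ => (√2)⁻¹ * (1 - ε * (t * (L - t)))) t =
      (√2)⁻¹ * (-(ε * (L - 2 * t))) := by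
    have hd := ((((hasDerivAt_id t).mul ((hasDerivAt_id t).const_sub L)).const_mul ε).const_sub
      1).const_mul (√2)⁻¹
    refine HasDerivAt.deriv (hd.congr_deriv ?_)
    simp only [id]
    ring
  have hpoly : ∫ t in (0:ℝ)..L, t * (L - t) = L ^ 3 / 6 := by
    have hF (t : ℝ) : HasDerivAt (fun t : ℝ => L * t ^ 2 / 2 - t ^ 3 / 3) (t * (L - t)) t := by
      have hd := (((hasDerivAt_pow 2 t).const_mul L).div_const 2).sub
        ((hasDerivAt_pow 3 t).div_const 3)
      refine hd.congr_deriv ?_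
      norm_num
      ring
    rw [integral_eq_sub_of_hasDerivAt (fun t _ => hF t)
      (Continuous.intervalIntegrable (by fun_prop) _ _)]
    ring
  refine (steklovRayleigh_le hL hlam h (a := fun t => (√2)⁻¹ * (1 - ε * (t * (L - t))))
    (by fun_prop) ?_).trans_eq ?_
  · simp only [mul_pow, hs]
    ring
  · have hsplit : (fun t : ℝ => (deriv (fun t : ℝ => (√2)⁻¹ * (1 - ε * (t * (L - t)))) t) ^ 2 *
        (h t) ^ 2 + lam * ((√2)⁻¹ * (1 - ε * (t * (L - t)))) ^ 2) =
        fun t => (lam / 2 - ε * lam * (t * (L - t))) + ε ^ 2 *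
          (((L - 2 * t) ^ 2 * (h t) ^ 2 + lam * (t * (L - t)) ^ 2) / 2) := by
      funext t
      rw [hderiv]
      simp only [mul_pow, hs]
      ring
    rw [hsplit, integral_add (Continuous.intervalIntegrable (by fun_prop) _ _)
      (Continuous.intervalIntegrable (by fun_prop) _ _),
      integral_sub (Continuous.intervalIntegrable (by fun_prop) _ _)
      (Continuous.intervalIntegrable (by fun_prop) _ _), integral_const_mul, integral_const_mul,
      hpoly, integral_const]
    simp only [smul_eq_mul]
    ring

theorem steklov_upper_bound (L lam : ℝ) (hL : 0 < L) (hlam : 0 < lam)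
    (h : ℝ → ℝ) (hcont : Continuous h)
    (hpos : ∀ t ∈ Icc (0:ℝ) L, 0 < h t) (h0 : h 0 = 1) (hLval : h L = 1) :
    steklovRayleigh lam L h < L * lam / 2 := by
  have hle := steklovRayleigh_le_quadratic hL.le hlam.le hcont
  have hD : 0 ≤ ∫ t in (0:ℝ)..L,
      ((L - 2 * t) ^ 2 * (h t) ^ 2 + lam * (t * (L - t)) ^ 2) / 2 :=
    integral_nonneg hL.le fun t _ => by positivity
  set D := ∫ t in (0:ℝ)..L, ((L - 2 * t) ^ 2 * (h t) ^ 2 + lam * (t * (L - t)) ^ 2) / 2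
  have hB : 0 < lam * (L ^ 3 / 6) := by positivity
  set B := lam * (L ^ 3 / 6)
  have hε : 0 < B / (D + 1) := by positivity
  have hmul : B / (D + 1) * (D + 1) = B := div_mul_cancel₀ _ (by positivity)
  refine (hle (B / (D + 1))).trans_lt ?_
  nlinarith [mul_pos hε hε]
end

section
/- Let L > 0 and λ > 0 be real numbers. Then the supremum, over all smooth functions h : ℝ → ℝ with h(t) > 0 for all t ∈ [0,L] and h(0) = h(L) = 1, of σ(λ,h,L), equals Lλ/2. (This is the variational form of the paper's Theorem 2: sup{σ_j(h) : h satisfies (H)} = Lλ_j/2.) -/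
open Set intervalIntegral

/-- The constant test function `1 / √2` bounds the Steklov–Rayleigh infimum from above. -/
theorem steklovRayleigh_le_s1 {L lam : ℝ} (hL : 0 ≤ L) (hlam : 0 ≤ lam) (h : ℝ → ℝ) :
    steklovRayleigh lam L h ≤ L * lam / 2 := by
  have hsq : (√(1 / 2) : ℝ) ^ 2 = 1 / 2 := Real.sq_sqrt (by norm_num)
  refine csInf_le ⟨0, ?_⟩ ⟨fun _ => √(1 / 2), contDiff_const, by simp only [hsq]; norm_num, ?_⟩
  · rintro x ⟨a, -, -, rfl⟩
    exact integral_nonneg hL fun t _ => by positivity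
  · simp only [deriv_const, hsq, zero_pow two_ne_zero, zero_mul, zero_add]
    rw [intervalIntegral.integral_const, smul_eq_mul]
    ring

/-- Weighted Cauchy–Schwarz inequality for the increment of a `C¹` function over a
subinterval `[u, v]` of `[0, L]`. -/
theorem sq_sub_le_integral_mul_integral {L u v : ℝ} (hu : 0 ≤ u) (huv : u ≤ v) (hv : v ≤ L)
    {a h : ℝ → ℝ} (ha : ContDiff ℝ 1 a) (hh : Continuous h) (hpos : ∀ t ∈ Icc 0 L, 0 < h t) :
    (a v - a u) ^ 2 ≤
      (∫ t in (0:ℝ)..L, ((h t) ^ 2)⁻¹) * ∫ t in (0:ℝ)..L, (deriv a t) ^ 2 * (h t) ^ 2 := by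
  have hda : Continuous (deriv a) := ha.continuous_deriv le_rfl
  have hL : 0 ≤ L := hu.trans (huv.trans hv)
  have hinv : ContinuousOn (fun t => ((h t) ^ 2)⁻¹) (Icc 0 L) :=
    (hh.pow 2).continuousOn.inv₀ fun t ht => (pow_pos (hpos t ht) 2).ne'
  set K := ∫ t in (0:ℝ)..L, ((h t) ^ 2)⁻¹
  set E := ∫ t in (0:ℝ)..L, (deriv a t) ^ 2 * (h t) ^ 2
  have key : ∀ c : ℝ, 2 * c * (a v - a u) ≤ E + c ^ 2 * K := by
    intro c
    have hFTC : ∫ t in u..v, deriv a t = a v - a u :=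
      integral_deriv_eq_sub (fun x _ => (ha.differentiable one_ne_zero) x)
        (hda.intervalIntegrable _ _)
    have hcont : ContinuousOn
        (fun t => (deriv a t) ^ 2 * (h t) ^ 2 + c ^ 2 * ((h t) ^ 2)⁻¹) (Icc 0 L) :=
      ((hda.pow 2).mul (hh.pow 2)).continuousOn.add (continuousOn_const.mul hinv)
    have hint := hcont.intervalIntegrable_of_Icc (μ := MeasureTheory.volume) hL
    calc 2 * c * (a v - a u) = ∫ t in u..v, 2 * c * deriv a t := by
          rw [integral_const_mul, hFTC]
      _ ≤ ∫ t in u..v, ((deriv a t) ^ 2 * (h t) ^ 2 + c ^ 2 * ((h t) ^ 2)⁻¹) := by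
          refine integral_mono_on huv ((hda.const_mul _).intervalIntegrable _ _)
            ((hcont.mono (Icc_subset_Icc hu hv)).intervalIntegrable_of_Icc huv) fun t ht => ?_
          have hp := hpos t ⟨hu.trans ht.1, ht.2.trans hv⟩
          have : (deriv a t) ^ 2 * (h t) ^ 2 + c ^ 2 * ((h t) ^ 2)⁻¹ - 2 * c * deriv a t
              = (deriv a t * h t - c * (h t)⁻¹) ^ 2 := by field_simp; ring
          nlinarith [sq_nonneg (deriv a t * h t - c * (h t)⁻¹)]
      _ ≤ ∫ t in (0:ℝ)..L, ((deriv a t) ^ 2 * (h t) ^ 2 + c ^ 2 * ((h t) ^ 2)⁻¹) := by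
          refine integral_mono_interval hu huv hv ?_ hint
          exact Filter.Eventually.of_forall fun t => by simp only [Pi.zero_apply]; positivity
      _ = E + c ^ 2 * K := by
          have hi : IntervalIntegrable (fun t => (deriv a t) ^ 2 * (h t) ^ 2)
            MeasureTheory.volume 0 L := ((hda.pow 2).mul (hh.pow 2)).intervalIntegrable _ _
          have hj : IntervalIntegrable (fun t => c ^ 2 * ((h t) ^ 2)⁻¹)
            MeasureTheory.volume 0 L :=
            (continuousOn_const.mul hinv).intervalIntegrable_of_Icc hL
          rw [integral_add hi hj, integral_const_mul]
  have := discrim_le_zero (a := K) (b := -(2 * (a v - a u))) (c := E)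
    fun c => by nlinarith [key c]
  rw [discrim] at this
  nlinarith

/-- If `∫ 1 / h²` is small, the Steklov–Rayleigh infimum is close to `L * lam / 2`. -/
theorem le_steklovRayleigh {L lam η : ℝ} (hL : 0 < L) (hlam : 0 < lam) (hη : 0 < η)
    {h : ℝ → ℝ} (hh : Continuous h) (hpos : ∀ t ∈ Icc 0 L, 0 < h t)
    (hK : lam * L * ∫ t in (0:ℝ)..L, ((h t) ^ 2)⁻¹ ≤ η) :
    L * lam / 2 / (1 + η) ≤ steklovRayleigh lam L h := by
  have hsq : (√(1 / 2) : ℝ) ^ 2 = 1 / 2 := Real.sq_sqrt (by norm_num)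
  refine le_csInf ⟨_, fun _ => √(1 / 2), contDiff_const, by simp only [hsq]; norm_num, rfl⟩ ?_
  rintro x ⟨a, ha, hbd, rfl⟩
  have hda : Continuous (deriv a) := ha.continuous_deriv le_rfl
  have hac : Continuous a := ha.continuous
  have hi : IntervalIntegrable (fun t => (deriv a t) ^ 2 * (h t) ^ 2)
    MeasureTheory.volume 0 L := ((hda.pow 2).mul (hh.pow 2)).intervalIntegrable _ _
  have hj : ∀ c : ℝ, IntervalIntegrable (fun t => c * (a t) ^ 2) MeasureTheory.volume 0 L :=
    fun c => ((hac.pow 2).const_mul c).intervalIntegrable _ _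
  rw [integral_add hi (hj lam), integral_const_mul]
  have hinc := fun u v (hu : 0 ≤ u) (huv : u ≤ v) (hv : v ≤ L) =>
    sq_sub_le_integral_mul_integral hu huv hv ha hh hpos
  have hE0 : 0 ≤ ∫ t in (0:ℝ)..L, (deriv a t) ^ 2 * (h t) ^ 2 :=
    integral_nonneg hL.le fun t _ => by positivity
  set K := ∫ t in (0:ℝ)..L, ((h t) ^ 2)⁻¹
  set E := ∫ t in (0:ℝ)..L, (deriv a t) ^ 2 * (h t) ^ 2
  have young : ∀ x y : ℝ, η * x ^ 2 ≤ (1 + η) * (η * y ^ 2 + (x - y) ^ 2) := fun x y => by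
    nlinarith [sq_nonneg (η * y - (x - y))]
  have hpt : ∀ t ∈ Icc 0 L, η ≤ 2 * (1 + η) * (K * E) + 2 * (1 + η) * η * (a t) ^ 2 := by
    intro t ht
    have h0 := mul_le_mul_of_nonneg_left (hinc 0 t le_rfl ht.1 ht.2) (by positivity : 0 ≤ 1 + η)
    have h1 := mul_le_mul_of_nonneg_left (hinc t L ht.1 ht.2 le_rfl) (by positivity : 0 ≤ 1 + η)
    nlinarith [young (a 0) (a t), young (a L) (a t)]
  have hmono := integral_mono_on hL.le intervalIntegrable_const
    (intervalIntegrable_const.add (hj (2 * (1 + η) * η))) hpt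
  rw [integral_add intervalIntegrable_const (hj _),
    integral_const_mul (2 * (1 + η) * η) fun t => (a t) ^ 2,
    intervalIntegral.integral_const, intervalIntegral.integral_const, smul_eq_mul, smul_eq_mul,
    sub_zero] at hmono
  set A := ∫ t in (0:ℝ)..L, (a t) ^ 2
  rw [div_le_iff₀ (by positivity)]
  have hKE : lam * L * K * E ≤ η * E := mul_le_mul_of_nonneg_right hK hE0
  have hscaled := mul_le_mul_of_nonneg_left hmono hlam.le
  have hKE' := mul_le_mul_of_nonneg_left hKE (by positivity : 0 ≤ 2 * (1 + η))
  refine le_of_mul_le_mul_left ?_ (by positivity : 0 < 2 * η)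
  linarith

/-- The integrals of `1 / h²` for the concave parabolas `h t = 1 + n t (L - t)` tend to zero. -/
theorem tendsto_integral_inv_sq_parabola {L : ℝ} (hL : 0 < L) :
    Filter.Tendsto (fun n : ℕ => ∫ t in (0:ℝ)..L, ((1 + n * (t * (L - t))) ^ 2)⁻¹)
      Filter.atTop (nhds 0) := by
  suffices H : Filter.Tendsto (fun n : ℕ => ∫ t in (0:ℝ)..L, ((1 + n * (t * (L - t))) ^ 2)⁻¹)
      Filter.atTop (nhds (∫ _ in (0:ℝ)..L, (0:ℝ))) by
    rwa [intervalIntegral.integral_zero] at H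
  refine tendsto_integral_filter_of_dominated_convergence (fun _ => 1) ?_ ?_
    intervalIntegrable_const ?_
  · exact Filter.Eventually.of_forall fun n => Measurable.aestronglyMeasurable (by fun_prop)
  · refine Filter.Eventually.of_forall fun n => Filter.Eventually.of_forall fun t ht => ?_
    rw [uIoc_of_le hL.le] at ht
    have : 0 ≤ (n : ℝ) * (t * (L - t)) :=
      mul_nonneg n.cast_nonneg (mul_nonneg ht.1.le (sub_nonneg.2 ht.2))
    rw [Real.norm_of_nonneg (by positivity)]
    exact inv_le_one_of_one_le₀ (one_le_pow₀ (by linarith))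
  · filter_upwards [MeasureTheory.Measure.ae_ne MeasureTheory.volume L] with t htL ht
    rw [uIoc_of_le hL.le] at ht
    have hpos : 0 < t * (L - t) := mul_pos ht.1 (sub_pos.2 (lt_of_le_of_ne ht.2 htL))
    refine Filter.Tendsto.inv_tendsto_atTop ?_
    refine (Filter.tendsto_pow_atTop two_ne_zero).comp ?_
    exact Filter.tendsto_atTop_add_const_left _ _
      (tendsto_natCast_atTop_atTop.atTop_mul_const hpos)

theorem steklov_sup_eq (L lam : ℝ) (hL : 0 < L) (hlam : 0 < lam) :
    sSup { x : ℝ | ∃ h : ℝ → ℝ, ContDiff ℝ (⊤ : ℕ∞) h ∧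
        (∀ t ∈ Icc (0:ℝ) L, 0 < h t) ∧ h 0 = 1 ∧ h L = 1 ∧
        x = steklovRayleigh lam L h } = L * lam / 2 := by
  refine csSup_eq_of_forall_le_of_forall_lt_exists_gt
    ⟨_, fun _ => 1, contDiff_const, fun _ _ => one_pos, rfl, rfl, rfl⟩ ?_ ?_
  · rintro x ⟨h, -, -, -, -, rfl⟩
    exact steklovRayleigh_le_s1 hL.le hlam.le h
  intro w hw
  obtain ⟨η, hη, hwη⟩ : ∃ η : ℝ, 0 < η ∧ w < L * lam / 2 / (1 + η) := by
    have hd : 0 < L * lam / 2 - w := sub_pos.2 hw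
    refine ⟨(L * lam / 2 - w) / (|w| + 1), by positivity, ?_⟩
    rw [lt_div_iff₀ (by positivity), mul_add, mul_one, ← lt_sub_iff_add_lt', mul_div_assoc',
      div_lt_iff₀ (by positivity)]
    nlinarith [le_abs_self w]
  have hlim := (tendsto_integral_inv_sq_parabola hL).const_mul (lam * L)
  rw [mul_zero] at hlim
  obtain ⟨n, hn⟩ := (hlim.eventually_le_const hη).exists
  have hpos : ∀ t ∈ Icc (0:ℝ) L, 0 < 1 + (n : ℝ) * (t * (L - t)) := fun t ht => by
    have := mul_nonneg (n.cast_nonneg (α := ℝ)) (mul_nonneg ht.1 (sub_nonneg.2 ht.2))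
    linarith
  exact ⟨_, ⟨fun t => 1 + n * (t * (L - t)), by fun_prop, hpos, by simp, by simp, rfl⟩,
    hwη.trans_le (le_steklovRayleigh hL hlam hη (by fun_prop) hpos hn)⟩
end

section
/- Let L > 0, λ > 0, and 0 < L₁ < L₂ < L, and let c > 0. Let h : ℝ → ℝ be continuous with h(t) > 0 for all t ∈ [0,L], h(0) = h(L) = 1, and h(t) ≤ c for all t ∈ [L₁,L₂]. Then σ(λ,h,L) ≤ Lλ/2 − γ, where γ = min{ λ(L₂−L₁)/4 , 3λ²(L₂−L₁)³ / (8(12c² + λ(L₂−L₁)²)) }. (This is the paper's Theorem 3.1 on approaching the supremum: if h is bounded above on a subinterval, σ_j(h) is quantitatively far from the supremum Lλ_j/2.) -/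
open Set intervalIntegral

theorem hasDerivAt_max_zero_sq (y : ℝ) :
    HasDerivAt (fun y : ℝ => max y 0 ^ 2) (2 * max y 0) y := by
  rcases lt_trichotomy y 0 with hy | rfl | hy
  · rw [max_eq_right hy.le, mul_zero]
    refine (hasDerivAt_const y (0 : ℝ)).congr_of_eventuallyEq ?_
    filter_upwards [Iio_mem_nhds hy] with z hz
    simp [max_eq_right (mem_Iio.1 hz).le]
  · rw [max_self, mul_zero, hasDerivAt_iff_isLittleO]
    have key : (fun x : ℝ => max x 0 ^ 2) =O[nhds 0] fun x : ℝ => x ^ 2 := by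
      refine Asymptotics.isBigO_of_le _ fun x => ?_
      rw [norm_pow, norm_pow]
      refine pow_le_pow_left₀ (norm_nonneg _) ?_ 2
      rw [Real.norm_eq_abs, Real.norm_eq_abs, abs_of_nonneg (le_max_right x 0)]
      exact max_le (le_abs_self x) (abs_nonneg x)
    simpa using key.trans_isLittleO (Asymptotics.isLittleO_pow_id one_lt_two)
  · rw [max_eq_left hy.le]
    have h2 : HasDerivAt (fun z : ℝ => z ^ 2) (2 * y) y := by
      simpa using hasDerivAt_pow 2 y
    refine h2.congr_of_eventuallyEq ?_
    filter_upwards [Ioi_mem_nhds hy] with z hz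
    rw [max_eq_left (mem_Ioi.1 hz).le]

/-- A `C¹` bump of mean `1 / 2` supported on `[0, 1]`. -/
noncomputable def bumpProfile (x : ℝ) : ℝ :=
  max (x * (1 - x)) 0 ^ 2 * (27 - 56 * (x * (1 - x)))

/-- The derivative of `bumpProfile`. -/
noncomputable def bumpProfileDeriv (x : ℝ) : ℝ :=
  2 * max (x * (1 - x)) 0 * (1 - 2 * x) * (27 - 56 * (x * (1 - x))) +
    max (x * (1 - x)) 0 ^ 2 * (-56 * (1 - 2 * x))

theorem hasDerivAt_bumpProfile (x : ℝ) :
    HasDerivAt bumpProfile (bumpProfileDeriv x) x := by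
  have hu : HasDerivAt (fun x : ℝ => x * (1 - x)) (1 - 2 * x) x := by
    refine ((hasDerivAt_id' x).fun_mul ((hasDerivAt_id' x).const_sub 1)).congr_deriv ?_
    ring
  refine (((hasDerivAt_max_zero_sq _).comp x hu).fun_mul
    ((hu.const_mul 56).const_sub 27)).congr_deriv ?_
  simp only [bumpProfileDeriv, Function.comp]
  ring

theorem continuous_bumpProfileDeriv : Continuous bumpProfileDeriv := by
  unfold bumpProfileDeriv
  fun_prop

theorem continuous_bumpProfile : Continuous bumpProfile := by
  unfold bumpProfile
  fun_prop

theorem bumpProfile_of_nonpos {x : ℝ} (hx : x * (1 - x) ≤ 0) : bumpProfile x = 0 := by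
  simp [bumpProfile, max_eq_right hx]

theorem bumpProfileDeriv_of_nonpos {x : ℝ} (hx : x * (1 - x) ≤ 0) :
    bumpProfileDeriv x = 0 := by
  simp [bumpProfileDeriv, max_eq_right hx]

/-- The quadratic energy of `1 - s * bumpProfile` on `[0, 1]`. -/
theorem integral_bumpProfile_energy_le {A B : ℝ} (hA : 0 ≤ A) (hB : 0 ≤ B) (s : ℝ) :
    ∫ x in (0:ℝ)..1, (A * (s * bumpProfileDeriv x) ^ 2 + B * (1 - s * bumpProfile x) ^ 2) ≤
      4 * A * s ^ 2 + B * (1 - s + s ^ 2 / 3) := by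
  have hderiv : ∀ x ∈ uIcc (0 : ℝ) 1, HasDerivAt (fun x : ℝ =>
      A * s ^ 2 * (972 * x ^ 3 - 8910 * x ^ 4 + 38628 * x ^ 5 - 100920 * x ^ 6
        + 1199088 / 7 * x ^ 7 - 191520 * x ^ 8 + 136640 * x ^ 9 - 56448 * x ^ 10
        + 112896 / 11 * x ^ 11)
      + B * (x - 2 * s * (9 * x ^ 3 - 55 / 2 * x ^ 4 + 39 * x ^ 5 - 28 * x ^ 6 + 8 * x ^ 7)
        + s ^ 2 * (729 / 5 * x ^ 5 - 990 * x ^ 6 + 22630 / 7 * x ^ 7 - 12993 / 2 * x ^ 8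
        + 26003 / 3 * x ^ 9 - 7784 * x ^ 10 + 50064 / 11 * x ^ 11 - 1568 * x ^ 12
        + 3136 / 13 * x ^ 13)))
      (A * (s * bumpProfileDeriv x) ^ 2 + B * (1 - s * bumpProfile x) ^ 2) x := by
    intro x hx
    rw [uIcc_of_le zero_le_one] at hx
    have hu : 0 ≤ x * (1 - x) := mul_nonneg hx.1 (by linarith [hx.2])
    have hp : ∀ (k : ℝ) (n : ℕ), HasDerivAt (fun x : ℝ => k * x ^ n) (k * (n * x ^ (n - 1))) x :=
      fun k n => (hasDerivAt_pow n x).const_mul k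
    simp only [bumpProfile, bumpProfileDeriv, max_eq_left hu]
    have hE := (((((((((hp 972 3).fun_sub (hp 8910 4)).fun_add (hp 38628 5)).fun_sub
      (hp 100920 6)).fun_add (hp (1199088 / 7) 7)).fun_sub (hp 191520 8)).fun_add
      (hp 136640 9)).fun_sub (hp 56448 10)).fun_add (hp (112896 / 11) 11)).const_mul (A * s ^ 2)
    have hM := (((((hp 9 3).fun_sub (hp (55 / 2) 4)).fun_add (hp 39 5)).fun_sub
      (hp 28 6)).fun_add (hp 8 7)).const_mul (2 * s)
    have hQ := (((((((((hp (729 / 5) 5).fun_sub (hp 990 6)).fun_add (hp (22630 / 7) 7)).fun_sub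
      (hp (12993 / 2) 8)).fun_add (hp (26003 / 3) 9)).fun_sub (hp 7784 10)).fun_add
      (hp (50064 / 11) 11)).fun_sub (hp 1568 12)).fun_add (hp (3136 / 13) 13)).const_mul (s ^ 2)
    refine (hE.fun_add ((((hasDerivAt_id' x).fun_sub hM).fun_add hQ).const_mul B)).congr_deriv ?_
    push_cast
    ring
  have hcont : Continuous fun x =>
      A * (s * bumpProfileDeriv x) ^ 2 + B * (1 - s * bumpProfile x) ^ 2 := by
    have := continuous_bumpProfileDeriv
    have := continuous_bumpProfile
    fun_prop
  rw [integral_eq_sub_of_hasDerivAt hderiv (hcont.intervalIntegrable _ _)]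
  have h1 := mul_nonneg hA (sq_nonneg s)
  have h2 := mul_nonneg hB (sq_nonneg s)
  norm_num
  nlinarith

theorem bddBelow_steklovRayleigh {lam L : ℝ} (hL : 0 ≤ L) (hlam : 0 ≤ lam) (h : ℝ → ℝ) :
    BddBelow { x : ℝ | ∃ a : ℝ → ℝ, ContDiff ℝ 1 a ∧ (a 0) ^ 2 + (a L) ^ 2 = 1 ∧
      x = ∫ t in (0:ℝ)..L, ((deriv a t) ^ 2 * (h t) ^ 2 + lam * (a t) ^ 2) } := by
  refine ⟨0, ?_⟩
  rintro x ⟨a, -, -, rfl⟩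
  exact integral_nonneg hL fun t _ => by positivity

theorem steklov_stability (L lam L₁ L₂ c : ℝ) (hL : 0 < L) (hlam : 0 < lam)
    (hL₁ : 0 < L₁) (hL₁₂ : L₁ < L₂) (hL₂ : L₂ < L) (hc : 0 < c)
    (h : ℝ → ℝ) (hcont : Continuous h)
    (hpos : ∀ t ∈ Icc (0:ℝ) L, 0 < h t) (h0 : h 0 = 1) (hLval : h L = 1)
    (hbd : ∀ t ∈ Icc L₁ L₂, h t ≤ c) :
    steklovRayleigh lam L h ≤ L * lam / 2 -
      min (lam * (L₂ - L₁) / 4)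
        (3 * lam ^ 2 * (L₂ - L₁) ^ 3 / (8 * (12 * c ^ 2 + lam * (L₂ - L₁) ^ 2))) := by
  set d := L₂ - L₁ with hd
  have hd0 : 0 < d := sub_pos.2 hL₁₂
  have hD : 0 < 12 * c ^ 2 + lam * d ^ 2 := by positivity
  set s := 3 * lam * d ^ 2 / (2 * (12 * c ^ 2 + lam * d ^ 2)) with hs
  obtain ⟨k, hk⟩ : ∃ k : ℝ, k ^ 2 = 1 / 2 := ⟨√(1 / 2), Real.sq_sqrt (by norm_num)⟩
  set y : ℝ → ℝ := fun t => t / d - L₁ / d with hy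
  set a : ℝ → ℝ := fun t => k * (1 - s * bumpProfile (y t)) with ha
  set a' : ℝ → ℝ := fun t => k * -(s * (bumpProfileDeriv (y t) * (1 / d))) with ha'
  have hycont : Continuous y := by fun_prop
  have hderiv : ∀ t, HasDerivAt a (a' t) t := fun t =>
    ((((hasDerivAt_bumpProfile (y t)).comp t
      (((hasDerivAt_id' t).div_const d).sub_const _)).const_mul s).const_sub 1).const_mul k
  have hda : deriv a = a' := funext fun t => (hderiv t).deriv
  have hacont : Continuous a := by
    have := continuous_bumpProfile.comp hycont
    simp only [Function.comp_def] at this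
    fun_prop
  have ha'cont : Continuous a' := by
    have := continuous_bumpProfileDeriv.comp hycont
    simp only [Function.comp_def] at this
    fun_prop
  have hC1 : ContDiff ℝ 1 a :=
    contDiff_one_iff_deriv.2 ⟨fun t => (hderiv t).differentiableAt, hda ▸ ha'cont⟩
  have hyeq : ∀ t, y t * (1 - y t) = (t - L₁) * (L₂ - t) / d ^ 2 := fun t => by
    have : L₂ = L₁ + d := by rw [hd]; ring
    rw [this, hy]
    field_simp
    ring
  have houtside : ∀ t, t ≤ L₁ ∨ L₂ ≤ t → y t * (1 - y t) ≤ 0 := fun t ht => by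
    rw [hyeq]
    refine div_nonpos_of_nonpos_of_nonneg ?_ (sq_nonneg d)
    rcases ht with ht | ht
    · exact mul_nonpos_of_nonpos_of_nonneg (by linarith) (by linarith)
    · exact mul_nonpos_of_nonneg_of_nonpos (by linarith) (by linarith)
  have haout : ∀ t, t ≤ L₁ ∨ L₂ ≤ t → a t = k := fun t ht => by
    simp [ha, bumpProfile_of_nonpos (houtside t ht)]
  have ha'out : ∀ t, t ≤ L₁ ∨ L₂ ≤ t → a' t = 0 := fun t ht => by
    simp [ha', bumpProfileDeriv_of_nonpos (houtside t ht)]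
  set f : ℝ → ℝ := fun t => deriv a t ^ 2 * h t ^ 2 + lam * a t ^ 2 with hf
  have hfcont : Continuous f := by
    simp only [hf, hda]
    fun_prop
  have hfout : ∀ t, t ≤ L₁ ∨ L₂ ≤ t → f t = lam / 2 := fun t ht => by
    simp only [hf, hda, haout t ht, ha'out t ht, hk]
    ring
  have hleft : ∫ t in (0:ℝ)..L₁, f t = L₁ * (lam / 2) := by
    rw [integral_congr (g := fun _ => lam / 2) fun t ht => hfout t (.inl ?_)]
    · simp [mul_div_assoc]
    · exact (uIcc_of_le hL₁.le ▸ ht).2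
  have hright : ∫ t in L₂..L, f t = (L - L₂) * (lam / 2) := by
    rw [integral_congr (g := fun _ => lam / 2) fun t ht => hfout t (.inr ?_)]
    · simp [mul_div_assoc]
    · exact (uIcc_of_le hL₂.le ▸ ht).1
  set G : ℝ → ℝ := fun x => c ^ 2 / (2 * d ^ 2) * (s * bumpProfileDeriv x) ^ 2 +
    lam / 2 * (1 - s * bumpProfile x) ^ 2 with hG
  have hGcont : Continuous G := by
    have := continuous_bumpProfileDeriv
    have := continuous_bumpProfile
    fun_prop
  have hmid : ∫ t in L₁..L₂, f t ≤
      d * (4 * (c ^ 2 / (2 * d ^ 2)) * s ^ 2 + lam / 2 * (1 - s + s ^ 2 / 3)) := by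
    calc ∫ t in L₁..L₂, f t ≤ ∫ t in L₁..L₂, G (t / d - L₁ / d) := by
          refine integral_mono_on hL₁₂.le (hfcont.intervalIntegrable _ _)
            ((hGcont.comp hycont).intervalIntegrable _ _) fun t ht => ?_
          have hh : h t ^ 2 ≤ c ^ 2 := pow_le_pow_left₀
            (hpos t ⟨hL₁.le.trans ht.1, ht.2.trans hL₂.le⟩).le (hbd t ht) 2
          calc f t ≤ a' t ^ 2 * c ^ 2 + lam * a t ^ 2 := by
                simp only [hf, hda]
                gcongr
            _ = G (y t) := by
                simp only [hG, ha, ha', mul_pow, neg_sq, hk]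
                field_simp
      _ = d * ∫ x in (0:ℝ)..1, G x := by
          have : L₂ / d - L₁ / d = 1 := by rw [← sub_div, ← hd, div_self hd0.ne']
          rw [integral_comp_div_sub _ hd0.ne', sub_self, this, smul_eq_mul]
      _ ≤ _ := by
          gcongr
          exact integral_bumpProfile_energy_le (by positivity) (by positivity) s
  have hsplit : ∫ t in (0:ℝ)..L, f t =
      (∫ t in (0:ℝ)..L₁, f t) + (∫ t in L₁..L₂, f t) + ∫ t in L₂..L, f t := by
    rw [integral_add_adjacent_intervals, integral_add_adjacent_intervals] <;>
      exact hfcont.intervalIntegrable _ _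
  have hgain : d * (4 * (c ^ 2 / (2 * d ^ 2)) * s ^ 2 + lam / 2 * (1 - s + s ^ 2 / 3)) =
      d * lam / 2 - 3 * lam ^ 2 * d ^ 3 / (8 * (12 * c ^ 2 + lam * d ^ 2)) := by
    rw [hs]
    field_simp
    ring
  have hle : steklovRayleigh lam L h ≤ ∫ t in (0:ℝ)..L, f t := by
    refine csInf_le (bddBelow_steklovRayleigh hL.le hlam.le h) ⟨a, hC1, ?_, rfl⟩
    rw [haout 0 (.inl hL₁.le), haout L (.inr hL₂.le), hk]
    norm_num
  have hmin := min_le_right (lam * d / 4)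
    (3 * lam ^ 2 * d ^ 3 / (8 * (12 * c ^ 2 + lam * d ^ 2)))
  have hlen : L₁ * (lam / 2) + d * lam / 2 + (L - L₂) * (lam / 2) = L * lam / 2 := by
    rw [hd]
    ring
  linarith
end

section
/- Let L > 0 and λ > 0 be real numbers, and let h : [0,L] → ℝ be a smooth function with h(t) > 0 for all t ∈ [0,L), h(L) = 0, and h'(L) = −1. Then σ_rev(λ,h,L) < Lλ/h(0)². (This is the strict upper bound of the paper's Theorem on metrics of revolution: σ_{(j)}(h) < Lλ_{(j)}/h(0)².) -/
open Set intervalIntegral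

/-- The revolution Steklov–Rayleigh infimum `σ_rev(λ, h, L)`: the infimum, over
continuously differentiable `a : ℝ → ℝ` with `a 0 = 1` and `a L = 0`, of
`(1 / h(0)²) ∫₀ᴸ (a'(t)² h(t)² + λ a(t)²) dt`. -/
noncomputable def steklovRayleighRev (lam L : ℝ) (h : ℝ → ℝ) : ℝ :=
  sInf { x : ℝ | ∃ a : ℝ → ℝ, ContDiff ℝ 1 a ∧ a 0 = 1 ∧ a L = 0 ∧
    x = (1 / (h 0) ^ 2) *
      ∫ t in (0:ℝ)..L, ((deriv a t) ^ 2 * (h t) ^ 2 + lam * (a t) ^ 2) }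

/-- A continuously differentiable function vanishing at `L` is bounded on `[0, L]` by a multiple
of the distance to `L`. -/
lemma exists_abs_le_mul_sub {L : ℝ} {h : ℝ → ℝ} (hh : ContDiff ℝ 1 h) (hLval : h L = 0) :
    ∃ C : ℝ, ∀ t ∈ Icc (0:ℝ) L, |h t| ≤ C * (L - t) := by
  obtain ⟨C, hC⟩ := (isCompact_Icc (a := (0:ℝ)) (b := L)).exists_bound_of_continuousOn
    (hh.continuous_deriv le_rfl).continuousOn
  refine ⟨C, fun t ht => ?_⟩
  have key := (convex_Icc (0:ℝ) L).norm_image_sub_le_of_norm_deriv_le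
    (fun x _ => (hh.differentiable one_ne_zero) x) hC (right_mem_Icc.2 (ht.1.trans ht.2)) ht
  rwa [hLval, sub_zero, Real.norm_eq_abs, Real.norm_eq_abs, abs_sub_comm,
    abs_of_nonneg (sub_nonneg.2 ht.2)] at key

/-- The value of the Rayleigh quotient at any admissible function bounds the infimum. -/
lemma steklovRayleighRev_le {lam L : ℝ} {h a : ℝ → ℝ} (hL : 0 ≤ L) (hlam : 0 ≤ lam)
    (ha : ContDiff ℝ 1 a) (ha0 : a 0 = 1) (haL : a L = 0) :
    steklovRayleighRev lam L h ≤ (1 / (h 0) ^ 2) *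
      ∫ t in (0:ℝ)..L, ((deriv a t) ^ 2 * (h t) ^ 2 + lam * (a t) ^ 2) := by
  refine csInf_le ⟨0, ?_⟩ ⟨a, ha, ha0, haL, rfl⟩
  rintro _ ⟨b, -, -, -, rfl⟩
  exact mul_nonneg (by positivity) (integral_nonneg hL fun t _ => by positivity)

/-- The trial function `1 - s u - (1 - s) u ^ (k + 1)` with `u = t / L`. -/
noncomputable def trialFun (L s : ℝ) (k : ℕ) (t : ℝ) : ℝ :=
  1 - s * (t / L) - (1 - s) * (t / L) ^ (k + 1)

lemma contDiff_trialFun (L s : ℝ) (k : ℕ) : ContDiff ℝ 1 (trialFun L s k) := by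
  unfold trialFun
  fun_prop

lemma deriv_trialFun (L s : ℝ) (k : ℕ) (t : ℝ) :
    deriv (trialFun L s k) t = -(s + (1 - s) * ((k + 1) * (t / L) ^ k)) / L := by
  have hu : HasDerivAt (fun t : ℝ => t / L) (1 / L) t := (hasDerivAt_id t).div_const L
  have := ((hu.const_mul s).const_sub 1).sub ((hu.pow (k + 1)).const_mul (1 - s))
  refine HasDerivAt.deriv (this.congr_deriv ?_)
  push_cast
  ring

/-- A function of `u = t / L` dominating the energy density of `trialFun L s k`. -/
def energyMajorant (lam C s : ℝ) (k : ℕ) (u : ℝ) : ℝ :=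
  2 * C ^ 2 * (s ^ 2 + (k + 1) ^ 2 * (u ^ (2 * k) - 2 * u ^ (2 * k + 1) + u ^ (2 * k + 2)))
    + lam * (1 - 2 * s * u + s ^ 2 * u ^ 2)

lemma continuous_energyMajorant (lam C s : ℝ) (k : ℕ) :
    Continuous (energyMajorant lam C s k) := by
  unfold energyMajorant
  fun_prop

lemma integral_energyMajorant (lam C s : ℝ) (k : ℕ) :
    ∫ u in (0:ℝ)..1, energyMajorant lam C s k u =
      2 * C ^ 2 * (s ^ 2 + (k + 1) / ((2 * k + 1) * (2 * k + 3))) + lam * (1 - s + s ^ 2 / 3) := by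
  have hderiv : ∀ u ∈ uIcc (0:ℝ) 1, HasDerivAt (fun u : ℝ =>
      2 * C ^ 2 * (s ^ 2 * u + (k + 1) ^ 2 * (u ^ (2 * k + 1) / (2 * k + 1)
        - 2 * (u ^ (2 * k + 2) / (2 * k + 2)) + u ^ (2 * k + 3) / (2 * k + 3)))
      + lam * (u - s * u ^ 2 + s ^ 2 * (u ^ 3 / 3))) (energyMajorant lam C s k u) u := by
    intro u _
    have hp (n : ℕ) : HasDerivAt (fun u : ℝ => u ^ n) (n * u ^ (n - 1)) u := hasDerivAt_pow n u
    have := ((((hasDerivAt_id u).const_mul (s ^ 2)).add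
      (((((hp (2 * k + 1)).div_const (2 * k + 1)).sub
        (((hp (2 * k + 2)).div_const (2 * k + 2)).const_mul 2)).add
        ((hp (2 * k + 3)).div_const (2 * k + 3))).const_mul (((k : ℝ) + 1) ^ 2))).const_mul
        (2 * C ^ 2)).add
      ((((hasDerivAt_id u).sub ((hp 2).const_mul s)).add
        (((hp 3).div_const 3).const_mul (s ^ 2))).const_mul lam)
    refine this.congr_deriv ?_
    unfold energyMajorant
    have h1 : (2 * (k : ℝ) + 1) ≠ 0 := by positivity
    have h2 : (2 * (k : ℝ) + 2) ≠ 0 := by positivity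
    have h3 : (2 * (k : ℝ) + 3) ≠ 0 := by positivity
    push_cast
    rw [mul_div_cancel_left₀ _ h1, mul_div_cancel_left₀ _ h2, mul_div_cancel_left₀ _ h3]
    ring
  rw [integral_eq_sub_of_hasDerivAt hderiv
    ((continuous_energyMajorant lam C s k).intervalIntegrable _ _)]
  simp only [one_pow, ne_eq, Nat.add_eq_zero_iff, one_ne_zero, OfNat.ofNat_ne_zero, and_false,
    not_false_eq_true, zero_pow]
  field_simp
  ring

lemma energy_trialFun_le {lam L C s x t : ℝ} (hL : 0 < L) (hlam : 0 ≤ lam) (hs0 : 0 ≤ s)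
    (hs1 : s ≤ 1) (k : ℕ) (ht : t ∈ Icc (0:ℝ) L) (hx : |x| ≤ C * (L - t)) :
    deriv (trialFun L s k) t ^ 2 * x ^ 2 + lam * trialFun L s k t ^ 2
      ≤ energyMajorant lam C s k (t / L) := by
  rw [deriv_trialFun]
  unfold trialFun energyMajorant
  have hu0 : 0 ≤ t / L := div_nonneg ht.1 hL.le
  have hu1 : t / L ≤ 1 := (div_le_one hL).2 ht.2
  have htu : L - t = L * (1 - t / L) := by field_simp
  rw [htu] at hx
  generalize t / L = u at *
  have hx2 : x ^ 2 ≤ (C * (L * (1 - u))) ^ 2 := by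
    rw [← sq_abs x]
    exact pow_le_pow_left₀ (abs_nonneg x) hx 2
  set p : ℝ := (k + 1) * u ^ k with hp
  have hp0 : 0 ≤ p := by positivity
  have hkin : (-(s + (1 - s) * p) / L) ^ 2 * x ^ 2
      ≤ 2 * C ^ 2 * (s ^ 2 + p ^ 2 * (1 - u) ^ 2) := by
    calc (-(s + (1 - s) * p) / L) ^ 2 * x ^ 2
        ≤ (-(s + (1 - s) * p) / L) ^ 2 * (C * (L * (1 - u))) ^ 2 := by gcongr
      _ = C ^ 2 * ((s + (1 - s) * p) * (1 - u)) ^ 2 := by field_simp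
      _ ≤ C ^ 2 * (s + p * (1 - u)) ^ 2 := by
          have h1 : 0 ≤ 1 - u := sub_nonneg.2 hu1
          have h2 : 0 ≤ 1 - s := sub_nonneg.2 hs1
          gcongr
          nlinarith [mul_nonneg hs0 hu0, mul_nonneg hs0 (mul_nonneg hp0 h1)]
      _ ≤ 2 * C ^ 2 * (s ^ 2 + p ^ 2 * (1 - u) ^ 2) := by
          nlinarith [mul_nonneg (sq_nonneg C) (sq_nonneg (s - p * (1 - u)))]
  have hpot : (1 - s * u - (1 - s) * u ^ (k + 1)) ^ 2 ≤ (1 - s * u) ^ 2 := by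
    have h2 : 0 ≤ 1 - s := sub_nonneg.2 hs1
    have h3 : u ^ (k + 1) ≤ 1 := pow_le_one₀ hu0 hu1
    have h4 : 0 ≤ u ^ (k + 1) := by positivity
    refine pow_le_pow_left₀ ?_ ?_ 2
    · nlinarith [mul_nonneg hs0 (sub_nonneg.2 hu1), mul_nonneg h2 (sub_nonneg.2 h3)]
    · linarith [mul_nonneg h2 h4]
  calc _ ≤ 2 * C ^ 2 * (s ^ 2 + p ^ 2 * (1 - u) ^ 2) + lam * (1 - s * u) ^ 2 := by gcongr
    _ = _ := by rw [hp]; ring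

/-- For small `s` and large `k` the majorant has mean strictly below `lam`. -/
lemma exists_integral_energyMajorant_lt {lam : ℝ} (hlam : 0 < lam) (C : ℝ) :
    ∃ s : ℝ, 0 ≤ s ∧ s ≤ 1 ∧ ∃ k : ℕ, ∫ u in (0:ℝ)..1, energyMajorant lam C s k u < lam := by
  have hD : 0 < 4 * C ^ 2 + lam := by positivity
  set s := lam / (4 * C ^ 2 + lam) with hs
  have hs0 : 0 < s := by positivity
  have hs1 : s ≤ 1 := (div_le_one hD).2 (by nlinarith [sq_nonneg C])
  obtain ⟨k, hk⟩ := exists_nat_one_div_lt (show 0 < s ^ 2 by positivity)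
  refine ⟨s, hs0.le, hs1, k, ?_⟩
  rw [integral_energyMajorant]
  have hle : ((k : ℝ) + 1) / ((2 * k + 1) * (2 * k + 3)) ≤ s ^ 2 := by
    refine le_trans ?_ hk.le
    rw [div_le_div_iff₀ (by positivity) (by positivity)]
    nlinarith [(Nat.cast_nonneg k : (0:ℝ) ≤ k)]
  have hmul : s * (4 * C ^ 2 + lam) = lam := div_mul_cancel₀ _ hD.ne'
  have hkin : 2 * C ^ 2 * (s ^ 2 + (k + 1) / ((2 * k + 1) * (2 * k + 3)))
      ≤ 2 * C ^ 2 * (s ^ 2 + s ^ 2) := by gcongr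
  have hsq : s * (s * (4 * C ^ 2 + lam)) = s * lam := by rw [hmul]
  nlinarith [mul_pos hlam (pow_pos hs0 2)]

theorem steklovRev_upper_bound (L lam : ℝ) (hL : 0 < L) (hlam : 0 < lam)
    (h : ℝ → ℝ) (hsmooth : ContDiff ℝ (⊤ : ℕ∞) h)
    (hpos : ∀ t ∈ Ico (0:ℝ) L, 0 < h t) (hLval : h L = 0)
    (hL' : deriv h L = -1) :
    steklovRayleighRev lam L h < L * lam / (h 0) ^ 2 := by
  have hh : ContDiff ℝ 1 h := hsmooth.of_le (by exact_mod_cast le_top)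
  obtain ⟨C, hC⟩ := exists_abs_le_mul_sub hh hLval
  obtain ⟨s, hs0, hs1, k, hlt⟩ := exists_integral_energyMajorant_lt hlam C
  have ha := contDiff_trialFun L s k
  have hh0 : 0 < h 0 := hpos 0 (left_mem_Ico.2 hL)
  have hcont : Continuous fun t =>
      deriv (trialFun L s k) t ^ 2 * h t ^ 2 + lam * trialFun L s k t ^ 2 :=
    (((ha.continuous_deriv le_rfl).pow 2).mul (hh.continuous.pow 2)).add
      (continuous_const.mul (ha.continuous.pow 2))
  have hle : ∫ t in (0:ℝ)..L, (deriv (trialFun L s k) t ^ 2 * h t ^ 2 + lam * trialFun L s k t ^ 2)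
      ≤ ∫ t in (0:ℝ)..L, energyMajorant lam C s k (t / L) :=
    integral_mono_on hL.le (hcont.intervalIntegrable _ _)
      (((continuous_energyMajorant lam C s k).comp
        (continuous_id.div_const L)).intervalIntegrable _ _)
      fun t ht => energy_trialFun_le hL hlam.le hs0 hs1 k ht (hC t ht)
  rw [integral_comp_div _ hL.ne', zero_div, div_self hL.ne', smul_eq_mul] at hle
  calc steklovRayleighRev lam L h
      ≤ (1 / (h 0) ^ 2) * ∫ t in (0:ℝ)..L,
          (deriv (trialFun L s k) t ^ 2 * h t ^ 2 + lam * trialFun L s k t ^ 2) :=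
        steklovRayleighRev_le hL.le hlam.le ha (by simp [trialFun])
          (by simp [trialFun, div_self hL.ne'])
    _ < (1 / (h 0) ^ 2) * (L * lam) := by
        refine mul_lt_mul_of_pos_left (hle.trans_lt ?_) (by positivity)
        exact mul_lt_mul_of_pos_left hlt hL
    _ = L * lam / (h 0) ^ 2 := by ring
end

section
/- Let L > 0 and λ > 0. There exists a constant C > 0, depending only on L and λ, such that for every ε with 0 < ε < min(1, L/4) and every continuous function h : ℝ → ℝ satisfying h(t) ≥ 1 for all t ∈ [0,L] and h(t) ≥ 1/ε for all t ∈ [2ε, L−2ε], one has σ(λ,h,L) ≥ Lλ/2 − C√ε. (This is the quantitative lower bound proved in the paper's Proposition 2.2, showing σ_{j,1}(h_ε) → λ_j L/2 as ε → 0.) -/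
open Set intervalIntegral

/-- If `f` is dominated by `(c * g + w) / 2` on `[p, q]`, with `c`, `w` constants, then so are
the integrals. -/
lemma integral_le_of_le_weighted {f g : ℝ → ℝ} (hf : Continuous f) (hg : Continuous g)
    {p q c w : ℝ} (hpq : p ≤ q) (hle : ∀ t ∈ Icc p q, f t ≤ (c * g t + w) / 2) :
    ∫ t in p..q, f t ≤ (c * (∫ t in p..q, g t) + w * (q - p)) / 2 := by
  have hmono := integral_mono_on (μ := MeasureTheory.volume) hpq (hf.intervalIntegrable p q)
    ((by fun_prop : Continuous fun t => (c * g t + w) / 2).intervalIntegrable p q) hle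
  rwa [intervalIntegral.integral_div, intervalIntegral.integral_add
    ((by fun_prop : Continuous fun t => c * g t).intervalIntegrable p q)
    (continuous_const.intervalIntegrable p q), intervalIntegral.integral_const_mul,
    intervalIntegral.integral_const, smul_eq_mul, mul_comm (q - p)] at hmono

/-- The total variation of `a` is controlled by its weighted Dirichlet energy, for a weight which
is large away from the ends of the interval. -/
lemma integral_abs_deriv_le {L ε : ℝ} (hε : 0 < ε) (hε1 : ε < 1) (hεL : ε < L / 4)
    {h : ℝ → ℝ} (hc : Continuous h) (h1 : ∀ t ∈ Icc (0 : ℝ) L, 1 ≤ h t)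
    (h2 : ∀ t ∈ Icc (2 * ε) (L - 2 * ε), 1 / ε ≤ h t)
    {d : ℝ → ℝ} (hd : Continuous d) :
    ∫ t in (0 : ℝ)..L, |d t| ≤
      √ε * ((∫ t in (0 : ℝ)..L, d t ^ 2 * h t ^ 2) + 4 + L) / 2 := by
  obtain ⟨s, hs, rfl⟩ : ∃ s : ℝ, 0 < s ∧ ε = s ^ 2 :=
    ⟨√ε, Real.sqrt_pos.2 hε, (Real.sq_sqrt hε.le).symm⟩
  rw [Real.sqrt_sq hs.le]
  set g : ℝ → ℝ := fun t => d t ^ 2 * h t ^ 2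
  have hg : Continuous g := by fun_prop
  have hf : Continuous fun t => |d t| := hd.abs
  have hend : ∀ t ∈ Icc (0 : ℝ) L, |d t| ≤ (s * g t + s⁻¹) / 2 := by
    intro t ht
    have hgt : |d t| ^ 2 ≤ g t := by
      rw [sq_abs]
      exact le_mul_of_one_le_right (sq_nonneg _) (one_le_pow₀ (h1 t ht))
    have hamgm : 2 * |d t| ≤ s * |d t| ^ 2 + s⁻¹ := by
      have : s * |d t| ^ 2 + s⁻¹ - 2 * |d t| = s⁻¹ * (s * |d t| - 1) ^ 2 := by
        field_simp
        ring
      nlinarith [mul_nonneg (inv_nonneg.2 hs.le) (sq_nonneg (s * |d t| - 1))]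
    nlinarith
  have hmid : ∀ t ∈ Icc (2 * s ^ 2) (L - 2 * s ^ 2), |d t| ≤ (s * g t + s) / 2 := by
    intro t ht
    have hh : 1 / s ^ 2 ≤ h t ^ 2 := by
      have h1s : 1 ≤ 1 / s ^ 2 := (one_le_div (by positivity)).2 hε1.le
      have := h2 t ht
      nlinarith
    have hgt : |d t| ^ 2 * (1 / s ^ 2) ≤ g t := by
      rw [sq_abs]
      exact mul_le_mul_of_nonneg_left hh (sq_nonneg _)
    have hamgm : 2 * |d t| ≤ s * (|d t| ^ 2 * (1 / s ^ 2)) + s := by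
      have : s * (|d t| ^ 2 * (1 / s ^ 2)) + s - 2 * |d t| = s⁻¹ * (|d t| - s) ^ 2 := by
        field_simp
        ring
      nlinarith [mul_nonneg (inv_nonneg.2 hs.le) (sq_nonneg (|d t| - s))]
    nlinarith
  have i1 := integral_le_of_le_weighted hf hg (p := 0) (q := 2 * s ^ 2) (by linarith)
    fun t ht => hend t ⟨ht.1, by linarith [ht.2]⟩
  have i2 := integral_le_of_le_weighted hf hg (by linarith) hmid
  have i3 := integral_le_of_le_weighted hf hg (p := L - 2 * s ^ 2) (q := L) (by linarith)
    fun t ht => hend t ⟨by linarith [ht.1], ht.2⟩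
  have hsplit : ∀ {f : ℝ → ℝ}, Continuous f → ∫ t in (0 : ℝ)..L, f t =
      (∫ t in (0 : ℝ)..2 * s ^ 2, f t) + (∫ t in 2 * s ^ 2..L - 2 * s ^ 2, f t) +
        ∫ t in L - 2 * s ^ 2..L, f t := fun {f} hf => by
    rw [integral_add_adjacent_intervals, integral_add_adjacent_intervals] <;>
      exact hf.intervalIntegrable _ _
  rw [hsplit hf, hsplit hg]
  have hinv : s⁻¹ * (2 * s ^ 2) = 2 * s := by field_simp
  have hs3 : 0 < s * s ^ 2 := by positivity
  rw [sub_zero, hinv] at i1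
  rw [sub_sub_cancel, hinv] at i3
  nlinarith

lemma abs_sub_le_integral_abs_deriv {a : ℝ → ℝ} (ha : ContDiff ℝ 1 a) {p q s t : ℝ}
    (hps : p ≤ s) (hst : s ≤ t) (htq : t ≤ q) :
    |a t - a s| ≤ ∫ x in p..q, |deriv a x| := by
  have hd : Continuous (deriv a) := ha.continuous_deriv le_rfl
  rw [← integral_deriv_eq_sub (fun x _ => (ha.differentiable one_ne_zero).differentiableAt)
    (hd.intervalIntegrable s t)]
  exact (abs_integral_le_integral_abs hst).trans <|
    integral_mono_interval hps hst htq (Filter.Eventually.of_forall fun x => abs_nonneg _)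
      (hd.abs.intervalIntegrable p q)

lemma sq_sub_two_mul_le_sq {x y δ : ℝ} (hy : y ^ 2 ≤ 1) (hxy : |x - y| ≤ δ) :
    y ^ 2 - 2 * δ ≤ x ^ 2 := by
  have hy1 : |y| ≤ 1 := (sq_le_one_iff_abs_le_one y).1 hy
  have hprod : |y * (x - y)| ≤ δ := by
    rw [abs_mul]
    nlinarith [abs_nonneg (x - y)]
  nlinarith [neg_abs_le (y * (x - y)), sq_nonneg (x - y)]

theorem steklov_quantitative_lower_bound (L lam : ℝ) (hL : 0 < L) (hlam : 0 < lam) :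
    ∃ C : ℝ, 0 < C ∧ ∀ ε : ℝ, 0 < ε → ε < min 1 (L / 4) →
      ∀ h : ℝ → ℝ, Continuous h →
        (∀ t ∈ Icc (0:ℝ) L, 1 ≤ h t) →
        (∀ t ∈ Icc (2 * ε) (L - 2 * ε), 1 / ε ≤ h t) →
        L * lam / 2 - C * Real.sqrt ε ≤ steklovRayleigh lam L h := by
  refine ⟨lam * L * (L * lam / 2 + 4 + L), by positivity, ?_⟩
  intro ε hε hεlt h hc h1 h2
  obtain ⟨hε1, hεL⟩ := lt_min_iff.1 hεlt
  refine le_csInf ⟨_, fun t => 1 - t / L, by fun_prop, by simp [hL.ne'], rfl⟩ ?_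
  rintro _ ⟨a, ha, hnorm, rfl⟩
  have hd : Continuous (deriv a) := ha.continuous_deriv le_rfl
  have hac : Continuous a := ha.continuous
  have hsum : ∫ t in (0:ℝ)..L, ((deriv a t) ^ 2 * (h t) ^ 2 + lam * (a t) ^ 2) =
      (∫ t in (0:ℝ)..L, deriv a t ^ 2 * h t ^ 2) + lam * ∫ t in (0:ℝ)..L, a t ^ 2 := by
    rw [intervalIntegral.integral_add, intervalIntegral.integral_const_mul]
    · exact (by fun_prop : Continuous fun t => deriv a t ^ 2 * h t ^ 2).intervalIntegrable _ _
    · exact (by fun_prop : Continuous fun t => lam * a t ^ 2).intervalIntegrable _ _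
  rw [hsum]
  set D := ∫ t in (0:ℝ)..L, deriv a t ^ 2 * h t ^ 2
  set A := ∫ t in (0:ℝ)..L, a t ^ 2
  have hD : 0 ≤ D := integral_nonneg hL.le fun t _ => by positivity
  have hA : 0 ≤ A := integral_nonneg hL.le fun t _ => by positivity
  have hlamA : 0 ≤ lam * A := by positivity
  rcases le_total (L * lam / 2) D with hbig | hsmall
  · have : 0 ≤ lam * L * (L * lam / 2 + 4 + L) * √ε := by positivity
    linarith
  · set V := ∫ t in (0:ℝ)..L, |deriv a t|
    have hV : V ≤ √ε * (D + 4 + L) / 2 := integral_abs_deriv_le hε hε1 hεL hc h1 h2 hd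
    have hVK : 2 * V ≤ √ε * (L * lam / 2 + 4 + L) := by
      nlinarith [mul_le_mul_of_nonneg_left hsmall (Real.sqrt_nonneg ε)]
    have hpt : ∀ t ∈ Icc (0:ℝ) L, 1 / 2 - 2 * V ≤ a t ^ 2 := by
      intro t ht
      have e0 := sq_sub_two_mul_le_sq (by nlinarith [sq_nonneg (a L)] : a 0 ^ 2 ≤ 1)
        (abs_sub_le_integral_abs_deriv ha le_rfl ht.1 ht.2)
      have eL := sq_sub_two_mul_le_sq (by nlinarith [sq_nonneg (a 0)] : a L ^ 2 ≤ 1)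
        (abs_sub_comm (a L) (a t) ▸ abs_sub_le_integral_abs_deriv ha ht.1 ht.2 le_rfl)
      linarith
    have hAlow : L * (1 / 2 - 2 * V) ≤ A := by
      have hmono := integral_mono_on (μ := MeasureTheory.volume) hL.le
        (continuous_const.intervalIntegrable 0 L)
        ((hac.pow 2).intervalIntegrable 0 L) hpt
      rwa [intervalIntegral.integral_const, smul_eq_mul, sub_zero] at hmono
    nlinarith [mul_le_mul_of_nonneg_left hAlow hlam.le,
      mul_le_mul_of_nonneg_left hVK (mul_pos hlam hL).le]
end

section
/- Let L > 0 and 0 < ε < L/4. Let h : ℝ → ℝ be continuous with h(t) ≥ 1 for all t ∈ [0,2ε] ∪ [L−2ε, L] and h(t) ≥ 1/ε for all t ∈ [2ε, L−2ε]. Then for every continuously differentiable function a : [0,L] → ℝ and every r ∈ [0,L], one has |a(r) − a(0)| ≤ (2√(2ε) + ε√L) · (∫₀ᴸ a'(t)² h(t)² dt)^{1/2}. (This is the key pointwise oscillation estimate, Equation (2.3) of the paper, proved via the Cauchy–Schwarz inequality on the three subintervals.) -/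
open Set intervalIntegral

/-- Cauchy–Schwarz for the increment of a `C¹` function. -/
theorem sq_sub_le_mul_integral_deriv_sq {a : ℝ → ℝ} (ha : ContDiff ℝ 1 a) {x y : ℝ}
    (hxy : x ≤ y) : (a y - a x) ^ 2 ≤ (y - x) * ∫ t in x..y, (deriv a t) ^ 2 := by
  have hc : Continuous (deriv a) := ha.continuous_deriv le_rfl
  have hftc : ∫ t in x..y, deriv a t = a y - a x :=
    integral_deriv_eq_sub (fun t _ => (ha.differentiable one_ne_zero) t)
      (hc.intervalIntegrable _ _)
  have hquad : ∀ l : ℝ, 0 ≤ (∫ t in x..y, (deriv a t) ^ 2) - 2 * l * (a y - a x)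
      + l ^ 2 * (y - x) := by
    intro l
    have hnonneg : 0 ≤ ∫ t in x..y, (deriv a t - l) ^ 2 :=
      integral_nonneg hxy fun t _ => sq_nonneg _
    have hexpand : ∫ t in x..y, (deriv a t - l) ^ 2 =
        (∫ t in x..y, (deriv a t) ^ 2) - 2 * l * (a y - a x) + l ^ 2 * (y - x) := by
      have hfun : ∀ t, (deriv a t - l) ^ 2 = (deriv a t) ^ 2 - 2 * l * deriv a t + l ^ 2 :=
        fun t => by ring
      simp only [hfun]
      rw [integral_add (Continuous.intervalIntegrable (by fun_prop) _ _)
          (Continuous.intervalIntegrable (by fun_prop) _ _),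
        integral_sub (Continuous.intervalIntegrable (by fun_prop) _ _)
          (Continuous.intervalIntegrable (by fun_prop) _ _),
        integral_const_mul, hftc, integral_const, smul_eq_mul]
      ring
    linarith
  rcases hxy.eq_or_lt with rfl | hlt
  · simp
  · have hpos : 0 < y - x := sub_pos.2 hlt
    have hmin := mul_nonneg hpos.le (hquad ((a y - a x) / (y - x)))
    have heq : (y - x) * ((∫ t in x..y, (deriv a t) ^ 2)
        - 2 * ((a y - a x) / (y - x)) * (a y - a x)
        + ((a y - a x) / (y - x)) ^ 2 * (y - x)) =
        (y - x) * (∫ t in x..y, (deriv a t) ^ 2) - (a y - a x) ^ 2 := by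
      field_simp
      ring
    linarith

/-- Oscillation on a subinterval on which the weight is bounded below. -/
theorem abs_sub_le_of_weight_ge {a h : ℝ → ℝ} (ha : ContDiff ℝ 1 a) (hcont : Continuous h)
    {L x y w c : ℝ} (hc : 0 < c) (hx : 0 ≤ x) (hxy : x ≤ y) (hy : y ≤ L) (hw : y - x ≤ w)
    (hh : ∀ t ∈ Icc x y, c ≤ h t) :
    |a y - a x| ≤ Real.sqrt w / c *
      Real.sqrt (∫ t in (0:ℝ)..L, (deriv a t) ^ 2 * (h t) ^ 2) := by
  have hd : Continuous (deriv a) := ha.continuous_deriv le_rfl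
  have hlower : c ^ 2 * (∫ t in x..y, (deriv a t) ^ 2) ≤
      ∫ t in x..y, (deriv a t) ^ 2 * (h t) ^ 2 := by
    rw [← integral_const_mul]
    refine integral_mono_on hxy (Continuous.intervalIntegrable (by fun_prop) _ _)
      (Continuous.intervalIntegrable (by fun_prop) _ _) fun t ht => ?_
    rw [mul_comm]
    exact mul_le_mul_of_nonneg_left (pow_le_pow_left₀ hc.le (hh t ht) 2) (sq_nonneg _)
  have hmono : (∫ t in x..y, (deriv a t) ^ 2 * (h t) ^ 2) ≤
      ∫ t in (0:ℝ)..L, (deriv a t) ^ 2 * (h t) ^ 2 :=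
    integral_mono_interval hx hxy hy (Filter.Eventually.of_forall fun t => by positivity)
      (Continuous.intervalIntegrable (by fun_prop) _ _)
  have hnonneg : 0 ≤ ∫ t in (0:ℝ)..L, (deriv a t) ^ 2 * (h t) ^ 2 :=
    integral_nonneg (hx.trans (hxy.trans hy)) fun t _ => by positivity
  have hw0 : 0 ≤ w := (sub_nonneg.2 hxy).trans hw
  rw [div_mul_eq_mul_div, le_div_iff₀ hc, ← Real.sqrt_mul hw0]
  apply Real.le_sqrt_of_sq_le
  calc (|a y - a x| * c) ^ 2 = c ^ 2 * (a y - a x) ^ 2 := by rw [mul_pow, sq_abs, mul_comm]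
    _ ≤ c ^ 2 * ((y - x) * ∫ t in x..y, (deriv a t) ^ 2) :=
        mul_le_mul_of_nonneg_left (sq_sub_le_mul_integral_deriv_sq ha hxy) (sq_nonneg c)
    _ = (y - x) * (c ^ 2 * ∫ t in x..y, (deriv a t) ^ 2) := by ring
    _ ≤ (y - x) * ∫ t in (0:ℝ)..L, (deriv a t) ^ 2 * (h t) ^ 2 :=
        mul_le_mul_of_nonneg_left (hlower.trans hmono) (sub_nonneg.2 hxy)
    _ ≤ w * ∫ t in (0:ℝ)..L, (deriv a t) ^ 2 * (h t) ^ 2 :=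
        mul_le_mul_of_nonneg_right hw hnonneg

theorem oscillation_estimate (L ε : ℝ) (hL : 0 < L) (hε : 0 < ε) (hεL : ε < L / 4)
    (h : ℝ → ℝ) (hcont : Continuous h)
    (h1 : ∀ t ∈ Icc (0:ℝ) (2 * ε) ∪ Icc (L - 2 * ε) L, 1 ≤ h t)
    (h2 : ∀ t ∈ Icc (2 * ε) (L - 2 * ε), 1 / ε ≤ h t)
    (a : ℝ → ℝ) (ha : ContDiff ℝ 1 a) (r : ℝ) (hr : r ∈ Icc (0:ℝ) L) :
    |a r - a 0| ≤ (2 * Real.sqrt (2 * ε) + ε * Real.sqrt L) *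
      Real.sqrt (∫ t in (0:ℝ)..L, (deriv a t) ^ 2 * (h t) ^ 2) := by
  obtain ⟨hr0, hrL⟩ := hr
  set E := Real.sqrt (∫ t in (0:ℝ)..L, (deriv a t) ^ 2 * (h t) ^ 2)
  have hs : 0 ≤ Real.sqrt (2 * ε) * E := by positivity
  have hm : 0 ≤ ε * Real.sqrt L * E := by positivity
  have left : ∀ y, 0 ≤ y → y ≤ 2 * ε → |a y - a 0| ≤ Real.sqrt (2 * ε) * E := by
    intro y hy0 hy
    simpa using abs_sub_le_of_weight_ge ha hcont one_pos le_rfl hy0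
      (by linarith : y ≤ L) (by linarith : y - 0 ≤ 2 * ε)
      fun t ht => h1 t (Or.inl ⟨ht.1, ht.2.trans hy⟩)
  have middle : ∀ y, 2 * ε ≤ y → y ≤ L - 2 * ε →
      |a y - a (2 * ε)| ≤ ε * Real.sqrt L * E := by
    intro y hy0 hy
    have := abs_sub_le_of_weight_ge ha hcont (one_div_pos.2 hε)
      (by linarith : 0 ≤ 2 * ε) hy0
      (by linarith : y ≤ L) (by linarith : y - 2 * ε ≤ L)
      fun t ht => h2 t ⟨ht.1, ht.2.trans hy⟩
    rwa [div_div_eq_mul_div, div_one, mul_comm (Real.sqrt L)] at this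
  rcases le_total r (2 * ε) with hr1 | hr1
  · linarith [left r hr0 hr1]
  have hleft := left (2 * ε) (by linarith) le_rfl
  rcases le_total r (L - 2 * ε) with hr2 | hr2
  · linarith [abs_sub_le (a r) (a (2 * ε)) (a 0), middle r hr1 hr2]
  have hright : |a r - a (L - 2 * ε)| ≤ Real.sqrt (2 * ε) * E := by
    simpa using abs_sub_le_of_weight_ge ha hcont one_pos
      (by linarith : 0 ≤ L - 2 * ε) hr2 hrL
      (by linarith : r - (L - 2 * ε) ≤ 2 * ε)
      fun t ht => h1 t (Or.inr ⟨ht.1, ht.2.trans hrL⟩)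
  linarith [abs_sub_le (a r) (a (2 * ε)) (a 0),
    abs_sub_le (a r) (a (L - 2 * ε)) (a (2 * ε)),
    middle (L - 2 * ε) (by linarith) le_rfl]
end

section
/- Let L > 0 and 0 < ε < L/4. Let h : ℝ → ℝ be continuous with h(t) ≥ 1 for all t ∈ [0,2ε] ∪ [L−2ε, L] and h(t) ≥ 1/ε for all t ∈ [2ε, L−2ε]. Then for every continuously differentiable function a : [0,L] → ℝ with a(L) = −a(0) and a(0)² + a(L)² = 1, one has ∫₀ᴸ a'(t)² h(t)² dt ≥ 2/(2√(2ε) + ε√L)². (This is the estimate used in the paper to show that the antisymmetric eigenvalue σ_{0,2}(h_ε) tends to +∞ as ε → 0.) -/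
open Set intervalIntegral

/-- Completing the square: on an interval where the weight is at least `c`, the weighted energy
dominates an affine function of the increment. -/
theorem weighted_energy_lower_bound {u v c : ℝ} (huv : u ≤ v) (hc : 0 < c) {h a : ℝ → ℝ}
    (hcont : Continuous h) (hh : ∀ t ∈ Icc u v, c ≤ h t) (ha : ContDiff ℝ 1 a) (l : ℝ) :
    2 * l * (a v - a u) - (l / c) ^ 2 * (v - u) ≤
      ∫ t in u..v, (deriv a t) ^ 2 * (h t) ^ 2 := by
  have hd : Continuous (deriv a) := ha.continuous_deriv le_rfl
  have hFTC : ∫ t in u..v, deriv a t = a v - a u :=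
    integral_deriv_eq_sub (fun t _ => (ha.differentiable one_ne_zero).differentiableAt)
      (hd.intervalIntegrable _ _)
  have hint : ∫ t in u..v, (2 * l * deriv a t - (l / c) ^ 2) =
      2 * l * (a v - a u) - (l / c) ^ 2 * (v - u) := by
    rw [integral_sub ((hd.const_mul _).intervalIntegrable _ _) intervalIntegrable_const,
      integral_const_mul, hFTC, integral_const, smul_eq_mul]
    ring
  rw [← hint]
  refine integral_mono_on huv (Continuous.intervalIntegrable (by fun_prop) _ _)
    (Continuous.intervalIntegrable (by fun_prop) _ _) fun t ht => ?_
  have hsq : c ^ 2 ≤ h t ^ 2 := pow_le_pow_left₀ hc.le (hh t ht) 2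
  have hmul := mul_le_mul_of_nonneg_left hsq (sq_nonneg (deriv a t))
  have hcancel : c * (l / c) = l := mul_div_cancel₀ l hc.ne'
  have hexp : (deriv a t * c - l / c) ^ 2 =
      deriv a t ^ 2 * c ^ 2 - 2 * (c * (l / c)) * deriv a t + (l / c) ^ 2 := by ring
  rw [hcancel] at hexp
  linarith [sq_nonneg (deriv a t * c - l / c)]

theorem antisymmetric_energy_lower_bound (L ε : ℝ) (hL : 0 < L) (hε : 0 < ε)
    (hεL : ε < L / 4) (h : ℝ → ℝ) (hcont : Continuous h)
    (h1 : ∀ t ∈ Icc (0:ℝ) (2 * ε) ∪ Icc (L - 2 * ε) L, 1 ≤ h t)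
    (h2 : ∀ t ∈ Icc (2 * ε) (L - 2 * ε), 1 / ε ≤ h t)
    (a : ℝ → ℝ) (ha : ContDiff ℝ 1 a) (hanti : a L = -a 0)
    (hnorm : (a 0) ^ 2 + (a L) ^ 2 = 1) :
    2 / (2 * Real.sqrt (2 * ε) + ε * Real.sqrt L) ^ 2 ≤
      ∫ t in (0:ℝ)..L, (deriv a t) ^ 2 * (h t) ^ 2 := by
  have hd : Continuous (deriv a) := ha.continuous_deriv le_rfl
  have hii (x y : ℝ) : IntervalIntegrable (fun t => (deriv a t) ^ 2 * (h t) ^ 2)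
      MeasureTheory.volume x y := Continuous.intervalIntegrable (by fun_prop) _ _
  set S := (2 * Real.sqrt (2 * ε) + ε * Real.sqrt L) ^ 2 with hS
  have hSpos : 0 < S := by positivity
  have hK : 4 * ε + ε ^ 2 * (L - 4 * ε) ≤ S := by
    have e1 := Real.sq_sqrt (show 0 ≤ 2 * ε by positivity)
    have e2 := Real.sq_sqrt hL.le
    have e3 : S = 4 * Real.sqrt (2 * ε) ^ 2 + ε ^ 2 * Real.sqrt L ^ 2 +
        4 * ε * (Real.sqrt (2 * ε) * Real.sqrt L) := by rw [hS]; ring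
    have e4 : 0 ≤ 4 * ε * (Real.sqrt (2 * ε) * Real.sqrt L) := by positivity
    rw [e1, e2] at e3
    nlinarith [pow_pos hε 3]
  have hD : (a L - a 0) ^ 2 = 2 := by
    rw [hanti] at hnorm ⊢
    linarith
  set l := (a L - a 0) / S with hl
  have b1 := weighted_energy_lower_bound (by linarith) one_pos hcont
    (fun t ht => h1 t (Or.inl ht)) ha l
  have b2 := weighted_energy_lower_bound (by linarith) (one_div_pos.2 hε) hcont h2 ha l
  have b3 := weighted_energy_lower_bound (by linarith) one_pos hcont
    (fun t ht => h1 t (Or.inr ht)) ha l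
  rw [← integral_add_adjacent_intervals (hii 0 (L - 2 * ε)) (hii (L - 2 * ε) L),
    ← integral_add_adjacent_intervals (hii 0 (2 * ε)) (hii (2 * ε) (L - 2 * ε))]
  have hl1 : l * (a L - a 0) = 2 / S := by rw [hl, div_mul_eq_mul_div, ← sq, hD]
  have hl2 : l ^ 2 * S = 2 / S := by
    rw [hl, div_pow, hD]
    field_simp
  have hl3 := mul_le_mul_of_nonneg_left hK (sq_nonneg l)
  rw [div_one] at b1 b3
  rw [div_div_eq_mul_div, div_one] at b2
  linarith
end

section
/- Let L > 0, λ > 0, and 0 < ε with 3ε ≤ L. Let h : ℝ → ℝ be continuous with h(t) > 0 for all t ∈ [0,L], h(0) = h(L) = 1, and h(t) ≤ ε² for all t ∈ [2ε, 3ε]. Then σ(λ,h,L) ≤ 3λε + ε³. (This is the estimate of the paper's Remark 2.3, obtained from the test function a equal to 1 on [0,2ε], equal to 3 − t/ε on [2ε,3ε], and equal to 0 on [3ε,L]; it shows there is no nontrivial lower bound for σ_j(h).) -/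
open Set intervalIntegral

/-- A `C¹` cutoff on the unit interval whose slope is at most a prescribed `M > 1`. -/
theorem exists_unit_cutoff {M : ℝ} (hM : 1 < M) :
    ∃ g φ : ℝ → ℝ, Continuous φ ∧ (∀ s, HasDerivAt g (φ s) s) ∧
      (∀ s ≤ 0, g s = 1) ∧ (∀ s, 1 ≤ s → g s = 0) ∧ (∀ s, 0 ≤ g s ∧ g s ≤ 1) ∧
      (∀ s, |φ s| ≤ M) ∧ (∀ s ≤ 0, φ s = 0) ∧ (∀ s, 1 ≤ s → φ s = 0) := by
  obtain ⟨n, hn⟩ := exists_nat_one_div_lt (sub_pos.2 hM)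
  have hn1 : (0 : ℝ) < n + 1 := by positivity
  set m : ℝ := 1 + 1 / (2 * (n + 1)) with hm
  have hm0 : 0 < m := by positivity
  have hmM : m ≤ M := by
    have : 1 / (2 * ((n : ℝ) + 1)) ≤ 1 / (n + 1) :=
      one_div_le_one_div_of_le hn1 (by linarith)
    linarith
  set ψ : ℝ → ℝ := fun s ↦ m * max 0 (1 - (2 * s - 1) ^ (2 * (n + 1))) with hψ
  have hψc : Continuous ψ := by fun_prop
  have hψ0 : ∀ s, 0 ≤ ψ s := fun s ↦ mul_nonneg hm0.le (le_max_left _ _)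
  have hψm : ∀ s, ψ s ≤ m := fun s ↦ by
    refine mul_le_of_le_one_right hm0.le (max_le zero_le_one ?_)
    have : 0 ≤ (2 * s - 1) ^ (2 * (n + 1)) := (even_two_mul _).pow_nonneg _
    linarith
  have hψout : ∀ s, 1 ≤ |2 * s - 1| → ψ s = 0 := fun s hs ↦ by
    have : 1 ≤ (2 * s - 1) ^ (2 * (n + 1)) := by
      rw [← (even_two_mul (n + 1)).pow_abs]
      exact one_le_pow₀ hs
    simp [hψ, max_eq_left (sub_nonpos.2 this)]
  have hψl : ∀ s ≤ 0, ψ s = 0 := fun s hs ↦ hψout s (le_abs.2 (Or.inr (by linarith)))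
  have hψr : ∀ s, 1 ≤ s → ψ s = 0 := fun s hs ↦ hψout s (le_abs.2 (Or.inl (by linarith)))
  have hψint : ∫ s in (0 : ℝ)..1, ψ s = 1 := by
    have hcongr : ∫ s in (0 : ℝ)..1, ψ s =
        ∫ s in (0 : ℝ)..1, m * (1 - (2 * s - 1) ^ (2 * (n + 1))) := by
      refine integral_congr fun s hs ↦ ?_
      rw [uIcc_of_le zero_le_one] at hs
      have : (2 * s - 1) ^ (2 * (n + 1)) ≤ 1 := by
        rw [← (even_two_mul (n + 1)).pow_abs]
        exact pow_le_one₀ (abs_nonneg _) (abs_le.2 ⟨by linarith [hs.1], by linarith [hs.2]⟩)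
      simp [hψ, max_eq_right (sub_nonneg.2 this)]
    have hpow : ∫ s in (0 : ℝ)..1, (2 * s - 1) ^ (2 * (n + 1)) = 1 / (2 * (n + 1) + 1) := by
      rw [integral_comp_mul_sub (fun x : ℝ ↦ x ^ (2 * (n + 1))) two_ne_zero, integral_pow]
      have : Odd (2 * (n + 1) + 1) := odd_two_mul_add_one _
      norm_num [this.neg_one_pow]
      field_simp
    rw [hcongr, integral_const_mul, integral_sub (by simp)
      (Continuous.intervalIntegrable (by fun_prop) _ _), hpow, hm]
    simp only [integral_const, sub_zero, smul_eq_mul, mul_one]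
    field_simp
    ring
  set g : ℝ → ℝ := fun s ↦ 1 - ∫ x in (0 : ℝ)..s, ψ x with hg
  have hderiv : ∀ s, HasDerivAt g (-ψ s) s := fun s ↦
    (hψc.integral_hasStrictDerivAt 0 s).hasDerivAt.const_sub 1
  have hgl : ∀ s ≤ 0, g s = 1 := fun s hs ↦ by
    have : ∫ x in (0 : ℝ)..s, ψ x = 0 := by
      refine (integral_congr (g := fun _ ↦ (0 : ℝ)) fun x hx ↦ ?_).trans (by simp)
      rw [uIcc_of_ge hs] at hx
      exact hψl x hx.2
    simp [hg, this]
  have hgr : ∀ s, 1 ≤ s → g s = 0 := fun s hs ↦ by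
    have : ∫ x in (1 : ℝ)..s, ψ x = 0 := by
      refine (integral_congr (g := fun _ ↦ (0 : ℝ)) fun x hx ↦ ?_).trans (by simp)
      rw [uIcc_of_le hs] at hx
      exact hψr x hx.1
    simp only [hg]
    rw [← integral_add_adjacent_intervals (hψc.intervalIntegrable 0 1)
      (hψc.intervalIntegrable 1 s), hψint, this]
    norm_num
  have hanti : Antitone g := antitone_of_deriv_nonpos (fun s ↦ (hderiv s).differentiableAt)
    fun s ↦ by rw [(hderiv s).deriv]; linarith [hψ0 s]
  refine ⟨g, fun s ↦ -ψ s, hψc.neg, hderiv, hgl, hgr, fun s ↦ ⟨?_, ?_⟩, fun s ↦ ?_,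
    fun s hs ↦ by simp [hψl s hs], fun s hs ↦ by simp [hψr s hs]⟩
  · exact (hgr _ (le_max_right s 1)).symm.le.trans (hanti (le_max_left s 1))
  · exact (hanti (min_le_left s 0)).trans (hgl _ (min_le_right s 0)).le
  · rw [abs_neg, abs_of_nonneg (hψ0 s)]
    exact (hψm s).trans hmM

theorem steklovRayleigh_le_integral {lam L : ℝ} (hL : 0 ≤ L) (hlam : 0 ≤ lam) (h : ℝ → ℝ)
    {a : ℝ → ℝ} (ha : ContDiff ℝ 1 a) (hbd : (a 0) ^ 2 + (a L) ^ 2 = 1) :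
    steklovRayleigh lam L h ≤
      ∫ t in (0 : ℝ)..L, ((deriv a t) ^ 2 * (h t) ^ 2 + lam * (a t) ^ 2) := by
  refine csInf_le ⟨0, ?_⟩ ⟨a, ha, hbd, rfl⟩
  rintro _ ⟨b, -, -, rfl⟩
  exact integral_nonneg hL fun t _ ↦ by positivity

theorem intervalIntegral_le_const_mul {f : ℝ → ℝ} (hf : Continuous f) {b c C : ℝ} (hbc : b ≤ c)
    (hC : ∀ t ∈ Icc b c, f t ≤ C) : ∫ t in b..c, f t ≤ (c - b) * C := by
  simpa using integral_mono_on hbc (hf.intervalIntegrable b c)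
    (continuous_const.intervalIntegrable (μ := MeasureTheory.volume) b c) hC

theorem steklovRayleigh_le_of_one_lt {L lam ε : ℝ} (hlam : 0 < lam) (hε : 0 < ε)
    (hεL : 3 * ε ≤ L) {h : ℝ → ℝ} (hcont : Continuous h)
    (hnonneg : ∀ t ∈ Icc (2 * ε) (3 * ε), 0 ≤ h t)
    (hsmall : ∀ t ∈ Icc (2 * ε) (3 * ε), h t ≤ ε ^ 2) {M : ℝ} (hM : 1 < M) :
    steklovRayleigh lam L h ≤ 3 * lam * ε + M ^ 2 * ε ^ 3 := by
  obtain ⟨g, φ, hφ, hgφ, hgl, hgr, hg01, hφM, hφl, hφr⟩ := exists_unit_cutoff hM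
  set a : ℝ → ℝ := fun t ↦ g (t / ε - 2) with ha
  have hda : ∀ t, HasDerivAt a (φ (t / ε - 2) / ε) t := fun t ↦ by
    have := (hgφ (t / ε - 2)).comp t (((hasDerivAt_id t).div_const ε).sub_const 2)
    simpa [ha, Function.comp_def, div_eq_mul_inv] using this
  have hderiv : deriv a = fun t ↦ φ (t / ε - 2) / ε := funext fun t ↦ (hda t).deriv
  have hdc : Continuous (deriv a) := by rw [hderiv]; fun_prop
  have hac : ContDiff ℝ 1 a :=
    contDiff_one_iff_deriv.2 ⟨fun t ↦ (hda t).differentiableAt, hdc⟩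
  have hleft : ∀ t ≤ 2 * ε, t / ε - 2 ≤ 0 := fun t ht ↦ by
    rw [sub_nonpos, div_le_iff₀ hε]; exact ht
  have hright : ∀ t, 3 * ε ≤ t → 1 ≤ t / ε - 2 := fun t ht ↦ by
    have := (le_div_iff₀ hε).2 ht
    linarith
  have hbd : (a 0) ^ 2 + (a L) ^ 2 = 1 := by
    simp [ha, hgl (0 / ε - 2) (hleft 0 (by positivity)), hgr _ (hright L hεL)]
  refine (steklovRayleigh_le_integral (by linarith) hlam.le h hac hbd).trans ?_
  set F : ℝ → ℝ := fun t ↦ (deriv a t) ^ 2 * (h t) ^ 2 + lam * (a t) ^ 2 with hF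
  have hFc : Continuous F := by
    have := hac.continuous
    fun_prop
  have hmass : ∀ t, lam * (a t) ^ 2 ≤ lam := fun t ↦
    mul_le_of_le_one_right hlam.le (pow_le_one₀ (hg01 _).1 (hg01 _).2)
  have h₁ : ∫ t in (0 : ℝ)..2 * ε, F t ≤ (2 * ε - 0) * lam :=
    intervalIntegral_le_const_mul hFc (by positivity) fun t ht ↦ by
      simpa [hF, hderiv, hφl _ (hleft t ht.2)] using hmass t
  have h₂ : ∫ t in 2 * ε..3 * ε, F t ≤ (3 * ε - 2 * ε) * (M ^ 2 * ε ^ 2 + lam) :=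
    intervalIntegral_le_const_mul hFc (by linarith) fun t ht ↦ by
      refine add_le_add ?_ (hmass t)
      have hφ2 : φ (t / ε - 2) ^ 2 ≤ M ^ 2 := sq_le_sq' (abs_le.1 (hφM _)).1 (abs_le.1 (hφM _)).2
      have hh2 : h t ^ 2 ≤ (ε ^ 2) ^ 2 := pow_le_pow_left₀ (hnonneg t ht) (hsmall t ht) 2
      calc deriv a t ^ 2 * h t ^ 2 = φ (t / ε - 2) ^ 2 / ε ^ 2 * h t ^ 2 := by
            rw [hderiv, div_pow]
        _ ≤ M ^ 2 / ε ^ 2 * (ε ^ 2) ^ 2 := by gcongr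
        _ = M ^ 2 * ε ^ 2 := by field_simp
  have h₃ : ∫ t in 3 * ε..L, F t ≤ (L - 3 * ε) * 0 :=
    intervalIntegral_le_const_mul hFc hεL fun t ht ↦ by
      have hat : a t = 0 := hgr _ (hright t ht.1)
      simp [hF, hderiv, hat, hφr _ (hright t ht.1)]
  rw [← integral_add_adjacent_intervals (hFc.intervalIntegrable 0 (3 * ε))
      (hFc.intervalIntegrable (3 * ε) L),
    ← integral_add_adjacent_intervals (hFc.intervalIntegrable 0 (2 * ε))
      (hFc.intervalIntegrable (2 * ε) (3 * ε))]
  linarith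

theorem steklov_no_lower_bound_estimate (L lam ε : ℝ) (hL : 0 < L)
    (hlam : 0 < lam) (hε : 0 < ε) (hεL : 3 * ε ≤ L)
    (h : ℝ → ℝ) (hcont : Continuous h)
    (hpos : ∀ t ∈ Icc (0:ℝ) L, 0 < h t) (h0 : h 0 = 1) (hLval : h L = 1)
    (hsmall : ∀ t ∈ Icc (2 * ε) (3 * ε), h t ≤ ε ^ 2) :
    steklovRayleigh lam L h ≤ 3 * lam * ε + ε ^ 3 := by
  have hlim : Filter.Tendsto (fun M : ℝ ↦ 3 * lam * ε + M ^ 2 * ε ^ 3) (nhdsWithin 1 (Ioi 1))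
      (nhds (3 * lam * ε + ε ^ 3)) := by
    have hc : Continuous fun M : ℝ ↦ 3 * lam * ε + M ^ 2 * ε ^ 3 := by fun_prop
    simpa using (hc.tendsto 1).mono_left nhdsWithin_le_nhds
  refine ge_of_tendsto hlim (eventually_mem_nhdsWithin.mono fun M hM ↦ ?_)
  exact steklovRayleigh_le_of_one_lt hlam hε hεL hcont
    (fun t ht ↦ (hpos t ⟨by linarith [ht.1], ht.2.trans hεL⟩).le) hsmall hM
end

section
/- Let L > 0 and λ > 0. The infimum, over all continuously differentiable functions a : [0,L] → ℝ satisfying a(0)² + a(L)² = 1, of ∫₀ᴸ (a'(t)² + λ a(t)²) dt, equals √λ · tanh(√λ L / 2), and it is attained by a suitable multiple of a(t) = cosh(√λ (t − L/2)). (This identifies the eigenvalue σ_{j,1} = √λ_j tanh(√λ_j L/2) of the cylinder [0,L]×Σ computed in the paper's Example 2.1.) -/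
open Set intervalIntegral Real

/-- The function `k * tanh (k * (t - m))` solves the Riccati equation `w' = k ^ 2 - w ^ 2`. -/
theorem hasDerivAt_mul_tanh (k m t : ℝ) :
    HasDerivAt (fun s => k * Real.tanh (k * (s - m)))
      (k ^ 2 - (k * Real.tanh (k * (t - m))) ^ 2) t := by
  have hu : HasDerivAt (fun s : ℝ => k * (s - m)) k t := by
    simpa using ((hasDerivAt_id t).sub_const m).const_mul k
  have hc : Real.cosh (k * (t - m)) ≠ 0 := (Real.cosh_pos _).ne'
  have h := (hu.sinh.div hu.cosh hc).const_mul k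
  have heq : (fun s => k * Real.tanh (k * (s - m))) =
      fun s => k * (Real.sinh (k * (s - m)) / Real.cosh (k * (s - m))) := by
    funext s
    rw [Real.tanh_eq_sinh_div_cosh]
  rw [heq]
  refine h.congr_deriv ?_
  rw [Real.tanh_eq_sinh_div_cosh]
  field_simp

/-- Completing the square in the Dirichlet-type energy by means of the Riccati solution
`k * tanh (k * (t - L / 2))`. -/
theorem integral_deriv_sq_add_eq (L k : ℝ) {a : ℝ → ℝ} (ha : ContDiff ℝ 1 a) :
    ∫ t in (0:ℝ)..L, ((deriv a t) ^ 2 + k ^ 2 * (a t) ^ 2) =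
      k * Real.tanh (k * L / 2) * ((a 0) ^ 2 + (a L) ^ 2) +
        ∫ t in (0:ℝ)..L, (deriv a t - k * Real.tanh (k * (t - L / 2)) * a t) ^ 2 := by
  have hd : Continuous (deriv a) := ha.continuous_deriv le_rfl
  have hac : Continuous a := ha.continuous
  have hw : Continuous fun t => k * Real.tanh (k * (t - L / 2)) :=
    continuous_iff_continuousAt.2 fun t => (hasDerivAt_mul_tanh k (L / 2) t).continuousAt
  have hderiv : ∀ t ∈ uIcc 0 L, HasDerivAt (fun s => k * Real.tanh (k * (s - L / 2)) * (a s) ^ 2)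
      (((deriv a t) ^ 2 + k ^ 2 * (a t) ^ 2) -
        (deriv a t - k * Real.tanh (k * (t - L / 2)) * a t) ^ 2) t := fun t _ => by
    have h1 : HasDerivAt a (deriv a t) t := (ha.differentiable one_ne_zero t).hasDerivAt
    refine ((hasDerivAt_mul_tanh k (L / 2) t).mul (h1.pow 2)).congr_deriv ?_
    simp only [Pi.pow_apply]
    push_cast
    ring
  have hE : Continuous fun t => (deriv a t) ^ 2 + k ^ 2 * (a t) ^ 2 := by fun_prop
  have hS : Continuous fun t => (deriv a t - k * Real.tanh (k * (t - L / 2)) * a t) ^ 2 :=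
    (hd.sub (hw.mul hac)).pow 2
  have hFTC := integral_eq_sub_of_hasDerivAt hderiv ((hE.sub hS).intervalIntegrable 0 L)
  rw [integral_sub (hE.intervalIntegrable 0 L) (hS.intervalIntegrable 0 L)] at hFTC
  have h0 : k * (0 - L / 2) = -(k * L / 2) := by ring
  have h1 : k * (L - L / 2) = k * L / 2 := by ring
  rw [h0, h1, Real.tanh_neg] at hFTC
  linarith

/-- The energy of `c * cosh (k * (t - L / 2))` in terms of its boundary values. -/
theorem integral_deriv_sq_add_cosh (L k c : ℝ) {a : ℝ → ℝ} (ha : ContDiff ℝ 1 a)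
    (hac : a = fun t => c * Real.cosh (k * (t - L / 2))) :
    ∫ t in (0:ℝ)..L, ((deriv a t) ^ 2 + k ^ 2 * (a t) ^ 2) =
      k * Real.tanh (k * L / 2) * ((a 0) ^ 2 + (a L) ^ 2) := by
  have hzero : ∀ t, deriv a t - k * Real.tanh (k * (t - L / 2)) * a t = 0 := fun t => by
    have hu : HasDerivAt (fun s : ℝ => k * (s - L / 2)) k t := by
      simpa using ((hasDerivAt_id t).sub_const (L / 2)).const_mul k
    have hc : Real.cosh (k * (t - L / 2)) ≠ 0 := (Real.cosh_pos _).ne'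
    rw [hac, (hu.cosh.const_mul c).deriv, Real.tanh_eq_sinh_div_cosh]
    field_simp
    ring
  rw [integral_deriv_sq_add_eq L k ha]
  simp [hzero]

theorem cylinder_sigma_j1 (L lam : ℝ) (hL : 0 < L) (hlam : 0 < lam) :
    sInf { x : ℝ | ∃ a : ℝ → ℝ, ContDiff ℝ 1 a ∧ (a 0) ^ 2 + (a L) ^ 2 = 1 ∧
        x = ∫ t in (0:ℝ)..L, ((deriv a t) ^ 2 + lam * (a t) ^ 2) } =
      Real.sqrt lam * Real.tanh (Real.sqrt lam * L / 2) ∧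
    ∃ c : ℝ, ∀ a : ℝ → ℝ,
      a = (fun t => c * Real.cosh (Real.sqrt lam * (t - L / 2))) →
      ContDiff ℝ 1 a ∧ (a 0) ^ 2 + (a L) ^ 2 = 1 ∧
      (∫ t in (0:ℝ)..L, ((deriv a t) ^ 2 + lam * (a t) ^ 2)) =
        Real.sqrt lam * Real.tanh (Real.sqrt lam * L / 2) := by
  obtain ⟨k, hk⟩ : ∃ k, k = Real.sqrt lam := ⟨_, rfl⟩
  have hlam_sq : lam = k ^ 2 := by rw [hk, Real.sq_sqrt hlam.le]
  rw [← hk, hlam_sq]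
  have hattained : ∃ c : ℝ, ∀ a : ℝ → ℝ,
      a = (fun t => c * Real.cosh (k * (t - L / 2))) →
      ContDiff ℝ 1 a ∧ (a 0) ^ 2 + (a L) ^ 2 = 1 ∧
      (∫ t in (0:ℝ)..L, ((deriv a t) ^ 2 + k ^ 2 * (a t) ^ 2)) =
        k * Real.tanh (k * L / 2) := by
    refine ⟨(Real.sqrt 2 * Real.cosh (k * L / 2))⁻¹, fun a ha => ?_⟩
    have hsmooth : ContDiff ℝ 1 a := by
      rw [ha]
      fun_prop
    have hbdry : (a 0) ^ 2 + (a L) ^ 2 = 1 := by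
      have h0 : k * (0 - L / 2) = -(k * L / 2) := by ring
      have h1 : k * (L - L / 2) = k * L / 2 := by ring
      have hc : Real.cosh (k * L / 2) ≠ 0 := (Real.cosh_pos _).ne'
      simp only [ha, h0, h1, Real.cosh_neg, mul_pow, inv_pow]
      rw [Real.sq_sqrt zero_le_two]
      field_simp
      norm_num
    refine ⟨hsmooth, hbdry, ?_⟩
    rw [integral_deriv_sq_add_cosh L k _ hsmooth ha, hbdry, mul_one]
  refine ⟨IsLeast.csInf_eq ⟨?_, ?_⟩, hattained⟩
  · obtain ⟨c, hc⟩ := hattained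
    obtain ⟨hsmooth, hbdry, henergy⟩ := hc _ rfl
    exact ⟨_, hsmooth, hbdry, henergy.symm⟩
  · rintro x ⟨a, ha, hbdry, rfl⟩
    rw [integral_deriv_sq_add_eq L k ha, hbdry, mul_one]
    exact le_add_of_nonneg_right (integral_nonneg hL.le fun t _ => sq_nonneg _)
end

section
/- Let L > 0 and λ > 0. The infimum, over all continuously differentiable functions a : [0,L] → ℝ satisfying a(L) = −a(0) and a(0)² + a(L)² = 1, of ∫₀ᴸ (a'(t)² + λ a(t)²) dt, equals √λ · coth(√λ L / 2), and it is attained by a suitable multiple of a(t) = sinh(√λ (t − L/2)). (This identifies the eigenvalue σ_{j,2} = √λ_j coth(√λ_j L/2) of the cylinder [0,L]×Σ computed in the paper's Example 2.1.) -/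
open Set intervalIntegral Real

theorem hasDerivAt_const_mul_sinh (c s m t : ℝ) :
    HasDerivAt (fun t => c * Real.sinh (s * (t - m))) (c * s * Real.cosh (s * (t - m))) t := by
  have h : HasDerivAt (fun t : ℝ => s * (t - m)) s t := by
    simpa using ((hasDerivAt_id t).sub_const m).const_mul s
  exact (h.sinh.const_mul c).congr_deriv (by ring)

theorem hasDerivAt_const_mul_cosh (c s m t : ℝ) :
    HasDerivAt (fun t => c * s * Real.cosh (s * (t - m)))
      (s ^ 2 * (c * Real.sinh (s * (t - m)))) t := by
  have h : HasDerivAt (fun t : ℝ => s * (t - m)) s t := by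
    simpa using ((hasDerivAt_id t).sub_const m).const_mul s
  exact (h.cosh.const_mul (c * s)).congr_deriv (by ring)

/-- The energy of `t ↦ c sinh (s (t - L / 2))` on `[0, L]`. -/
theorem integral_energy_sinh (L s c : ℝ) :
    (∫ t in (0:ℝ)..L, ((deriv (fun t => c * Real.sinh (s * (t - L / 2))) t) ^ 2 +
        s ^ 2 * (c * Real.sinh (s * (t - L / 2))) ^ 2)) =
      2 * c ^ 2 * s * Real.sinh (s * L / 2) * Real.cosh (s * L / 2) := by
  simp only [fun t => (hasDerivAt_const_mul_sinh c s (L / 2) t).deriv]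
  rw [integral_eq_sub_of_hasDerivAt (f := fun t => (c * Real.sinh (s * (t - L / 2))) *
    (c * s * Real.cosh (s * (t - L / 2))))]
  · have h1 : s * (L - L / 2) = s * L / 2 := by ring
    have h0 : s * (0 - L / 2) = -(s * L / 2) := by ring
    simp only [h1, h0, Real.sinh_neg, Real.cosh_neg]
    ring
  · intro t _
    exact ((hasDerivAt_const_mul_sinh c s (L / 2) t).mul
      (hasDerivAt_const_mul_cosh c s (L / 2) t)).congr_deriv (by ring)
  · exact Continuous.intervalIntegrable (by fun_prop) _ _

/-- Among `C¹` functions with the same boundary values, the hyperbolic sine minimizes the energy. -/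
theorem le_integral_energy {L s c : ℝ} (hL : 0 ≤ L) {a : ℝ → ℝ} (ha : ContDiff ℝ 1 a)
    (h0 : a 0 = -(c * Real.sinh (s * L / 2))) (h1 : a L = c * Real.sinh (s * L / 2)) :
    2 * c ^ 2 * s * Real.sinh (s * L / 2) * Real.cosh (s * L / 2) ≤
      ∫ t in (0:ℝ)..L, ((deriv a t) ^ 2 + s ^ 2 * (a t) ^ 2) := by
  have hd : Continuous (deriv a) := ha.continuous_deriv le_rfl
  have hc : Continuous a := ha.continuous
  have hG : (∫ t in (0:ℝ)..L, (2 * (deriv a t * (c * s * Real.cosh (s * (t - L / 2))) +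
        a t * (s ^ 2 * (c * Real.sinh (s * (t - L / 2))))) -
      ((c * s * Real.cosh (s * (t - L / 2))) * (c * s * Real.cosh (s * (t - L / 2))) +
        (c * Real.sinh (s * (t - L / 2))) * (s ^ 2 * (c * Real.sinh (s * (t - L / 2))))))) =
      2 * c ^ 2 * s * Real.sinh (s * L / 2) * Real.cosh (s * L / 2) := by
    rw [integral_eq_sub_of_hasDerivAt (f := fun t =>
      2 * (a t * (c * s * Real.cosh (s * (t - L / 2)))) -
        (c * Real.sinh (s * (t - L / 2))) * (c * s * Real.cosh (s * (t - L / 2))))]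
    · have e1 : s * (L - L / 2) = s * L / 2 := by ring
      have e0 : s * (0 - L / 2) = -(s * L / 2) := by ring
      simp only [e1, e0, Real.sinh_neg, Real.cosh_neg, h0, h1]
      ring
    · intro t _
      have hat : HasDerivAt a (deriv a t) t :=
        (ha.differentiable one_ne_zero t).hasDerivAt
      exact ((hat.mul (hasDerivAt_const_mul_cosh c s (L / 2) t)).const_mul 2).sub
        ((hasDerivAt_const_mul_sinh c s (L / 2) t).mul (hasDerivAt_const_mul_cosh c s (L / 2) t))
    · exact Continuous.intervalIntegrable (by fun_prop) _ _
  rw [← hG]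
  refine integral_mono_on hL (Continuous.intervalIntegrable (by fun_prop) _ _)
    (Continuous.intervalIntegrable (by fun_prop) _ _) fun t _ => ?_
  linarith [sq_nonneg (deriv a t - c * s * Real.cosh (s * (t - L / 2))),
    sq_nonneg (s * (a t - c * Real.sinh (s * (t - L / 2))))]

theorem cylinder_sigma_j2 (L lam : ℝ) (hL : 0 < L) (hlam : 0 < lam) :
    sInf { x : ℝ | ∃ a : ℝ → ℝ, ContDiff ℝ 1 a ∧ a L = -a 0 ∧
        (a 0) ^ 2 + (a L) ^ 2 = 1 ∧
        x = ∫ t in (0:ℝ)..L, ((deriv a t) ^ 2 + lam * (a t) ^ 2) } =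
      Real.sqrt lam * (Real.cosh (Real.sqrt lam * L / 2) / Real.sinh (Real.sqrt lam * L / 2)) ∧
    ∃ c : ℝ, ∀ a : ℝ → ℝ,
      a = (fun t => c * Real.sinh (Real.sqrt lam * (t - L / 2))) →
      ContDiff ℝ 1 a ∧ a L = -a 0 ∧ (a 0) ^ 2 + (a L) ^ 2 = 1 ∧
      (∫ t in (0:ℝ)..L, ((deriv a t) ^ 2 + lam * (a t) ^ 2)) =
        Real.sqrt lam * (Real.cosh (Real.sqrt lam * L / 2) / Real.sinh (Real.sqrt lam * L / 2)) := by
  obtain ⟨s, hs, rfl⟩ : ∃ s : ℝ, 0 < s ∧ lam = s ^ 2 :=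
    ⟨√lam, Real.sqrt_pos.2 hlam, (Real.sq_sqrt hlam.le).symm⟩
  rw [Real.sqrt_sq hs.le]
  have hS : 0 < Real.sinh (s * L / 2) := Real.sinh_pos_iff.2 (by positivity)
  have hval {c : ℝ} (h : 2 * (c * Real.sinh (s * L / 2)) ^ 2 = 1) :
      2 * c ^ 2 * s * Real.sinh (s * L / 2) * Real.cosh (s * L / 2) =
        s * (Real.cosh (s * L / 2) / Real.sinh (s * L / 2)) := by
    field_simp
    linear_combination h
  have hmin : ∃ c : ℝ, ∀ a : ℝ → ℝ, a = (fun t => c * Real.sinh (s * (t - L / 2))) →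
      ContDiff ℝ 1 a ∧ a L = -a 0 ∧ (a 0) ^ 2 + (a L) ^ 2 = 1 ∧
      (∫ t in (0:ℝ)..L, ((deriv a t) ^ 2 + s ^ 2 * (a t) ^ 2)) =
        s * (Real.cosh (s * L / 2) / Real.sinh (s * L / 2)) := by
    have hc : 2 * (1 / (√2 * Real.sinh (s * L / 2)) * Real.sinh (s * L / 2)) ^ 2 = 1 := by
      field_simp
      simp
    refine ⟨1 / (√2 * Real.sinh (s * L / 2)), ?_⟩
    generalize 1 / (√2 * Real.sinh (s * L / 2)) = c at hc
    rintro a rfl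
    have e1 : s * (L - L / 2) = s * L / 2 := by ring
    have e0 : s * (0 - L / 2) = -(s * L / 2) := by ring
    refine ⟨by fun_prop, ?_, ?_, (integral_energy_sinh L s c).trans (hval hc)⟩
    · simp only [e1, e0, Real.sinh_neg]
      ring
    · simp only [e1, e0, Real.sinh_neg]
      linear_combination hc
  refine ⟨IsLeast.csInf_eq ⟨?_, ?_⟩, hmin⟩
  · obtain ⟨c, hc⟩ := hmin
    obtain ⟨h1, h2, h3, h4⟩ := hc _ rfl
    exact ⟨_, h1, h2, h3, h4.symm⟩
  · rintro x ⟨a, ha, hanti, hnorm, rfl⟩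
    have h1 : a L = a L / Real.sinh (s * L / 2) * Real.sinh (s * L / 2) := by field_simp
    have h0 : a 0 = -(a L / Real.sinh (s * L / 2) * Real.sinh (s * L / 2)) := by
      rw [← h1, hanti, neg_neg]
    rw [← hval (c := a L / Real.sinh (s * L / 2))]
    · exact le_integral_energy hL.le ha h0 h1
    · rw [← h1]
      rw [hanti] at hnorm ⊢
      linear_combination hnorm
end
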